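/- For positive integers a₁ ≥ a₂ ≥ a₃, the complete 3-partite graph K_{a₁,a₂,a₃} is NIC-planar if and only if a₂ = 1, or (a₁ ≤ 4 and a₂ = 2 and a₃ = 1), or a₁ = a₂ = a₃ = 2. -/

import Mathlib

open Set

/-- Two subsets of the plane *properly cross* at a point `p`: in some open
neighbourhood of `p` the pair of sets looks, up to homeomorphism, like the two
coordinate axes meeting at the origin. -/
def ProperCross (A₁ A₂ : Set (ℝ × ℝ)) (p : ℝ × ℝ) : Prop :=
  ∃ U : Set (ℝ × ℝ), IsOpen U ∧ ∃ hp : p ∈ U, ∃ φ : U ≃ₜ (ℝ × ℝ),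
    φ ⟨p, hp⟩ = (0, 0) ∧
    (fun x => φ x) '' {x : U | (x : ℝ × ℝ) ∈ A₁} = {q : ℝ × ℝ | q.2 = 0} ∧
    (fun x => φ x) '' {x : U | (x : ℝ × ℝ) ∈ A₂} = {q : ℝ × ℝ | q.1 = 0}

/-- A drawing of a simple graph `G` in the plane: vertices go to distinct points,
each edge is drawn as a continuous injective arc joining the points of its two
endpoints, no arc passes through the point of a vertex other than its endpoints,
arcs of edges sharing an endpoint meet only at that common point, any two arcs
meet in finitely many points, every intersection point of two arcs that is not a
common endpoint is a proper crossing, and no point of the plane that is not a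
vertex point lies on more than two arcs. -/
structure Drawing {V : Type*} (G : SimpleGraph V) where
  pos : V → ℝ × ℝ
  pos_inj : Function.Injective pos
  arc : G.edgeSet → ℝ → ℝ × ℝ
  arc_cont : ∀ e, ContinuousOn (arc e) (Icc 0 1)
  arc_inj : ∀ e, InjOn (arc e) (Icc 0 1)
  arc_ends : ∀ e : G.edgeSet, ∃ u v : V, (e : Sym2 V) = s(u, v) ∧
    arc e 0 = pos u ∧ arc e 1 = pos v
  no_vertex_interior : ∀ (e : G.edgeSet) (v : V), v ∉ (e : Sym2 V) →
    pos v ∉ arc e '' Icc 0 1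
  shared_endpoint : ∀ e₁ e₂ : G.edgeSet, e₁ ≠ e₂ → ∀ v : V,
    v ∈ (e₁ : Sym2 V) → v ∈ (e₂ : Sym2 V) →
    arc e₁ '' Icc 0 1 ∩ arc e₂ '' Icc 0 1 ⊆ {pos v}
  finite_meet : ∀ e₁ e₂ : G.edgeSet, e₁ ≠ e₂ →
    (arc e₁ '' Icc 0 1 ∩ arc e₂ '' Icc 0 1).Finite
  proper : ∀ e₁ e₂ : G.edgeSet, e₁ ≠ e₂ →
    ∀ p ∈ arc e₁ '' Icc 0 1 ∩ arc e₂ '' Icc 0 1, p ∉ Set.range pos →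
    ProperCross (arc e₁ '' Icc 0 1) (arc e₂ '' Icc 0 1) p
  at_most_two : ∀ p : ℝ × ℝ, p ∉ Set.range pos →
    ∀ e₁ e₂ e₃ : G.edgeSet, p ∈ arc e₁ '' Icc 0 1 → p ∈ arc e₂ '' Icc 0 1 →
      p ∈ arc e₃ '' Icc 0 1 → e₁ = e₂ ∨ e₁ = e₃ ∨ e₂ = e₃

namespace Drawing

variable {V : Type*} {G : SimpleGraph V}

/-- The image of the arc drawn for the edge `e`. -/
def arcIm (D : Drawing G) (e : G.edgeSet) : Set (ℝ × ℝ) :=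
  D.arc e '' Icc 0 1

/-- The set of crossings of the drawing: points that are not vertex points and
lie on (at least, hence exactly) two arcs.  (An intersection point of two arcs
that is a common endpoint of the two edges is a vertex point, and conversely a
vertex point on two arcs is a common endpoint, so these are precisely the
intersection points of pairs of arcs that are not common endpoints.) -/
def crossings (D : Drawing G) : Set (ℝ × ℝ) :=
  {p | p ∉ Set.range D.pos ∧ ∃ e₁ e₂ : G.edgeSet, e₁ ≠ e₂ ∧ p ∈ D.arcIm e₁ ∧ p ∈ D.arcIm e₂}

/-- The number of crossings of the drawing. -/
noncomputable def crossingCount (D : Drawing G) : ℕ := D.crossings.ncard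

/-- The cluster set `S(c)` of a crossing `c`: the set of end-vertices of the
(two) edges whose arcs pass through `c`. -/
def cluster (D : Drawing G) (c : ℝ × ℝ) : Set V :=
  {v | ∃ e : G.edgeSet, c ∈ D.arcIm e ∧ v ∈ (e : Sym2 V)}

/-- A drawing is 1-planar if each edge's arc is crossed at most once. -/
def IsOnePlanar (D : Drawing G) : Prop :=
  ∀ e : G.edgeSet, {p | p ∈ D.crossings ∧ p ∈ D.arcIm e}.Subsingleton

/-- A drawing is NIC-planar if it is 1-planar and the cluster sets of any two
distinct crossings share at most one vertex. -/
def IsNICPlanar (D : Drawing G) : Prop :=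
  D.IsOnePlanar ∧ ∀ c₁ ∈ D.crossings, ∀ c₂ ∈ D.crossings, c₁ ≠ c₂ →
    (D.cluster c₁ ∩ D.cluster c₂).ncard ≤ 1

/-- A drawing is IC-planar if it is 1-planar and the cluster sets of any two
distinct crossings are disjoint. -/
def IsICPlanar (D : Drawing G) : Prop :=
  D.IsOnePlanar ∧ ∀ c₁ ∈ D.crossings, ∀ c₂ ∈ D.crossings, c₁ ≠ c₂ →
    D.cluster c₁ ∩ D.cluster c₂ = ∅

end Drawing

/-- A graph is 1-planar if it admits a 1-planar drawing. -/
def SimpleGraph.OnePlanar {V : Type*} (G : SimpleGraph V) : Prop :=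
  ∃ D : Drawing G, D.IsOnePlanar

/-- A graph is NIC-planar if it admits an NIC-planar drawing. -/
def SimpleGraph.NICPlanar {V : Type*} (G : SimpleGraph V) : Prop :=
  ∃ D : Drawing G, D.IsNICPlanar

/-- A graph is IC-planar if it admits an IC-planar drawing. -/
def SimpleGraph.ICPlanar {V : Type*} (G : SimpleGraph V) : Prop :=
  ∃ D : Drawing G, D.IsICPlanar

/-- The crossing number of `G`: the minimum number of crossings over all
drawings of `G`. -/
noncomputable def SimpleGraph.crossingNumber {V : Type*} (G : SimpleGraph V) : ℕ :=
  sInf {n | ∃ D : Drawing G, D.crossingCount = n}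
/-- The graph `H` is a minimum non-NIC-planar graph: `H` is not NIC-planar but
deleting any single edge of `H` yields an NIC-planar graph. -/
def MinNonNICPlanar {V : Type*} (H : SimpleGraph V) : Prop :=
  ¬ H.NICPlanar ∧ ∀ e ∈ H.edgeSet, (H.deleteEdges {e}).NICPlanar

/-- The graph `H` is a minimum non-IC-planar graph: `H` is not IC-planar but
deleting any single edge of `H` yields an IC-planar graph. -/
def MinNonICPlanar {V : Type*} (H : SimpleGraph V) : Prop :=
  ¬ H.ICPlanar ∧ ∀ e ∈ H.edgeSet, (H.deleteEdges {e}).ICPlanar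

/-- The complete multipartite graph with parts of sizes `a 0, …, a (k-1)`. -/
abbrev completeMultipartite {k : ℕ} (a : Fin k → ℕ) :
    SimpleGraph (Σ i : Fin k, Fin (a i)) :=
  SimpleGraph.completeMultipartiteGraph fun i => Fin (a i)

/-- `G` contains a subgraph isomorphic to `H`, i.e. there is an injective graph
homomorphism from `H` to `G`. -/
def ContainsSubgraphIso {V W : Type*} (G : SimpleGraph V) (H : SimpleGraph W) : Prop :=
  ∃ f : H →g G, Function.Injective f

section K33

theorem exists_continuous_log {A : Type*} [TopologicalSpace A] [SimplyConnectedSpace A]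
    [LocallyPathConnectedSpace A] {g : A → ℂ} (hg : Continuous g) (h0 : ∀ a, g a ≠ 0) :
    ∃ L : A → ℂ, Continuous L ∧ ∀ a, Complex.exp (L a) = g a := by
  obtain ⟨a₀⟩ : Nonempty A := inferInstance
  obtain ⟨F, ⟨-, hF⟩, -⟩ := Complex.isCoveringMapOn_exp.existsUnique_continuousMap_lifts
    ⟨g, hg⟩ (a₀ := a₀) (Complex.exp_log (h0 a₀)) h0
  exact ⟨F, F.continuous, fun a => congrFun hF a⟩

theorem log_increment_unique {L M : ℝ → ℂ} (hL : Continuous L) (hM : Continuous M) (c : ℂ)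
    (h : ∀ t, Complex.exp (L t) = c * Complex.exp (M t)) : L 1 - L 0 = M 1 - M 0 := by
  obtain ⟨F, -, hF⟩ := Complex.isCoveringMapOn_exp.existsUnique_continuousMap_lifts
    (⟨fun t => Complex.exp (L t), by fun_prop⟩ : C(ℝ, ℂ)) (a₀ := 0) (e₀ := L 0) rfl
    (fun a => Complex.exp_ne_zero _)
  have h1 := hF ⟨L, hL⟩ ⟨rfl, rfl⟩
  have h2 := hF ⟨fun t => M t + (L 0 - M 0), by fun_prop⟩ ⟨by simp, by
    funext t
    simp only [ContinuousMap.coe_mk, Function.comp_apply, Complex.exp_add, Complex.exp_sub, h]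
    field_simp⟩
  have h3 := congrArg (fun f : C(ℝ, ℂ) => f 1) (h1.trans h2.symm)
  simp only [ContinuousMap.coe_mk] at h3
  rw [h3]; ring

open Classical in
/-- The increment over `[0, 1]` of a continuous logarithm of `g`. -/
noncomputable def logIncrement (g : ℝ → ℂ) : ℂ :=
  if h : ∃ L : ℝ → ℂ, Continuous L ∧ ∀ t, Complex.exp (L t) = g t then
    h.choose 1 - h.choose 0 else 0

theorem logIncrement_eq {g L : ℝ → ℂ} (hL : Continuous L) (c : ℂ)
    (h : ∀ t, Complex.exp (L t) = c * g t) (h0 : c ≠ 0) : logIncrement g = L 1 - L 0 := by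
  have hex : ∃ L : ℝ → ℂ, Continuous L ∧ ∀ t, Complex.exp (L t) = g t :=
    ⟨fun t => L t - Complex.log c, by fun_prop, fun t => by
      rw [Complex.exp_sub, Complex.exp_log h0, h]; field_simp⟩
  rw [logIncrement, dif_pos hex]
  refine log_increment_unique hex.choose_spec.1 hL c⁻¹ fun t => ?_
  rw [hex.choose_spec.2, h]; field_simp

theorem exists_logIncrement_eq {g : ℝ → ℂ} (hg : Continuous g) (h0 : ∀ t, g t ≠ 0) :
    ∃ n : ℤ, logIncrement g =
      Complex.log (g 1) - Complex.log (g 0) + n * (2 * Real.pi * Complex.I) := by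
  obtain ⟨L, hL, h⟩ := exists_continuous_log hg h0
  rw [logIncrement_eq hL 1 (by simpa using h) one_ne_zero]
  have key : ∀ t, ∃ n : ℤ, L t = Complex.log (g t) + n * (2 * Real.pi * Complex.I) := fun t => by
    rw [← Complex.exp_eq_exp_iff_exists_int, h, Complex.exp_log (h0 t)]
  obtain ⟨n, hn⟩ := key 1
  obtain ⟨m, hm⟩ := key 0
  exact ⟨n - m, by rw [hn, hm]; push_cast; ring⟩

theorem exists_log_neg {z : ℂ} (hz : z ≠ 0) :
    ∃ k : ℤ, Complex.log (-z) - Complex.log z = (2 * k + 1) * (Real.pi * Complex.I) := by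
  have : Complex.exp (Complex.log (-z)) = Complex.exp (Complex.log z + Real.pi * Complex.I) := by
    rw [Complex.exp_add, Complex.exp_log hz, Complex.exp_log (neg_ne_zero.2 hz), Complex.exp_pi_mul_I]
    ring
  obtain ⟨n, hn⟩ := Complex.exp_eq_exp_iff_exists_int.1 this
  exact ⟨n, by rw [hn]; ring⟩

/-- The logarithm increments along the boundary of the square `[0, 1]²` of the difference of two
disjoint curves add up to zero. -/
theorem logIncrement_square {e f : ℝ → ℂ} (he : Continuous e) (hf : Continuous f)
    (h : ∀ s t, e s ≠ f t) :
    logIncrement (fun t => f t - e 0) - logIncrement (fun t => f t - e 1)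
      + logIncrement (fun s => e s - f 1) - logIncrement (fun s => e s - f 0) = 0 := by
  obtain ⟨L, hL, hexp⟩ := exists_continuous_log (A := ℝ × ℝ) (g := fun p => f p.2 - e p.1)
    (by fun_prop) (fun p => sub_ne_zero.2 (h _ _).symm)
  have h1 : ∀ s, logIncrement (fun t => f t - e s) = L (s, 1) - L (s, 0) := fun s =>
    logIncrement_eq (L := fun t => L (s, t)) (by fun_prop) 1 (by simp [hexp]) one_ne_zero
  have h2 : ∀ t, logIncrement (fun s => e s - f t) = L (1, t) - L (0, t) := fun t =>
    logIncrement_eq (L := fun s => L (s, t)) (by fun_prop) (-1) (by simp [hexp]) (by simp)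
  rw [h1, h1, h2, h2]; ring

/-- `K₃,₃` is not planar: among nine paths joining three points to three points there are
two paths without common end that meet. -/
theorem exists_meet_of_paths_complex (a b : Fin 3 → ℂ) (γ : ∀ i j, Path (a i) (b j)) :
    ∃ i i' j j', i ≠ i' ∧ j ≠ j' ∧ (range (γ i j) ∩ range (γ i' j')).Nonempty := by
  by_contra! hcon
  have hdis : ∀ i i' j j', i ≠ i' → j ≠ j' → ∀ s t : ℝ, (γ i j).extend s ≠ (γ i' j').extend t := by
    intro i i' j j' hi hj s t hst
    have := hcon i i' j j' hi hj
    refine (this ▸ (?_ : (γ i j).extend s ∈ range (γ i j) ∩ range (γ i' j')) :)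
    constructor
    · rw [← Path.extend_range]; exact mem_range_self s
    · rw [hst, ← Path.extend_range]; exact mem_range_self t
  have third : ∀ i : Fin 3, ∃ j, i ≠ j := by decide
  have hA : ∀ i i' j', i ≠ i' → ∀ t : ℝ, (γ i' j').extend t - a i ≠ 0 := by
    intro i i' j' hi t
    obtain ⟨j, hj⟩ := third j'
    have := hdis i i' j j' hi hj.symm 0 t
    rw [Path.extend_zero] at this
    exact sub_ne_zero.2 this.symm
  have hB : ∀ j i' j', j ≠ j' → ∀ t : ℝ, (γ i' j').extend t - b j ≠ 0 := by
    intro j i' j' hj t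
    obtain ⟨i, hi⟩ := third i'
    have := hdis i i' j j' hi.symm hj 1 t
    rw [Path.extend_one] at this
    exact sub_ne_zero.2 this.symm
  have hab : ∀ i j, b j - a i ≠ 0 := by
    intro i j
    obtain ⟨i', hi⟩ := third i
    have := hA i i' j hi 1
    rwa [Path.extend_one] at this
  have haa : ∀ i i', i ≠ i' → a i' - a i ≠ 0 := by
    intro i i' hi
    have := hA i i' 0 hi 0
    rwa [Path.extend_zero] at this
  have hbb : ∀ j j', j ≠ j' → b j' - b j ≠ 0 := by
    intro j j' hj
    have := hB j 0 j' hj 1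
    rwa [Path.extend_one] at this
  have hna : ∀ i i' j', ∃ n : ℤ, i ≠ i' → logIncrement (fun t => (γ i' j').extend t - a i) =
      Complex.log (b j' - a i) - Complex.log (a i' - a i) + n * (2 * Real.pi * Complex.I) := by
    intro i i' j'
    by_cases hi : i = i'
    · exact ⟨0, fun h => absurd hi h⟩
    obtain ⟨n, hn⟩ := exists_logIncrement_eq
      (g := fun t => (γ i' j').extend t - a i)
      ((γ i' j').continuous_extend.sub continuous_const) (hA i i' j' hi)
    exact ⟨n, fun _ => by simpa using hn⟩
  have hnb : ∀ j i' j', ∃ n : ℤ, j ≠ j' → logIncrement (fun t => (γ i' j').extend t - b j) =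
      Complex.log (b j' - b j) - Complex.log (a i' - b j) + n * (2 * Real.pi * Complex.I) := by
    intro j i' j'
    by_cases hj : j = j'
    · exact ⟨0, fun h => absurd hj h⟩
    obtain ⟨n, hn⟩ := exists_logIncrement_eq
      (g := fun t => (γ i' j').extend t - b j)
      ((γ i' j').continuous_extend.sub continuous_const) (hB j i' j' hj)
    exact ⟨n, fun _ => by simpa using hn⟩
  have hkab : ∀ i j, ∃ k : ℤ, Complex.log (a i - b j) - Complex.log (b j - a i) =
      (2 * k + 1) * (Real.pi * Complex.I) := by
    intro i j
    simpa using exists_log_neg (hab i j)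
  have hkaa : ∀ i i', ∃ k : ℤ, i ≠ i' → Complex.log (a i - a i') - Complex.log (a i' - a i) =
      (2 * k + 1) * (Real.pi * Complex.I) := by
    intro i i'
    by_cases hi : i = i'
    · exact ⟨0, fun h => absurd hi h⟩
    obtain ⟨k, hk⟩ := exists_log_neg (haa i i' hi)
    exact ⟨k, fun _ => by simpa using hk⟩
  have hkbb : ∀ j j', ∃ k : ℤ, j ≠ j' → Complex.log (b j - b j') - Complex.log (b j' - b j) =
      (2 * k + 1) * (Real.pi * Complex.I) := by
    intro i i'
    by_cases hi : i = i'
    · exact ⟨0, fun h => absurd hi h⟩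
    obtain ⟨k, hk⟩ := exists_log_neg (hbb i i' hi)
    exact ⟨k, fun _ => by simpa using hk⟩
  choose na hna using hna
  choose nb hnb using hnb
  choose kab hkab using hkab
  choose ka hka using hkaa
  choose kb hkb using hkbb
  have hpi : (Real.pi * Complex.I : ℂ) ≠ 0 := by simp [Real.pi_ne_zero]
  have hkb' : ∀ j j', j ≠ j' → kb j j' + kb j' j = -1 := by
    intro j j' hj
    have h : ((kb j j' + kb j' j + 1 : ℤ) : ℂ) * (2 * (Real.pi * Complex.I)) = 0 := by
      push_cast
      linear_combination -(hkb j j' hj) - hkb j' j hj.symm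
    have := (mul_eq_zero.1 h).resolve_right (mul_ne_zero two_ne_zero hpi)
    have : kb j j' + kb j' j + 1 = 0 := by exact_mod_cast this
    omega
  have main : ∀ i i' j j', i ≠ i' → j ≠ j' →
      ka i i' + kb j j' - kab i j' + kab i' j + 1 + na i i' j' - nb j i' j' + nb j' i j
        - na i' i j = 0 := by
    intro i i' j j' hi hj
    have hsq := logIncrement_square (γ i j).continuous_extend (γ i' j').continuous_extend
      (hdis i i' j j' hi hj)
    simp only [Path.extend_zero, Path.extend_one] at hsq
    rw [hna i i' j' hi, hnb j i' j' hj, hna i' i j hi.symm, hnb j' i j hj.symm] at hsq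
    have h : ((ka i i' + kb j j' - kab i j' + kab i' j + 1 + na i i' j' - nb j i' j' + nb j' i j
        - na i' i j : ℤ) : ℂ) * (2 * (Real.pi * Complex.I)) = 0 := by
      push_cast
      linear_combination hsq - hka i i' hi - hkb j j' hj + hkab i j' - hkab i' j
    have := (mul_eq_zero.1 h).resolve_right (mul_ne_zero two_ne_zero hpi)
    exact_mod_cast this
  have e01 := hkb' 0 1 (by decide)
  have e02 := hkb' 0 2 (by decide)
  have e12 := hkb' 1 2 (by decide)
  have m := fun i i' (hi : i ≠ i') =>
    (⟨main i i' 0 1 hi (by decide), main i i' 0 2 hi (by decide), main i i' 1 2 hi (by decide),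
    main i i' 1 0 hi (by decide), main i i' 2 0 hi (by decide), main i i' 2 1 hi (by decide)⟩ :
    _ ∧ _ ∧ _ ∧ _ ∧ _ ∧ _)
  obtain ⟨p1, p2, p3, p4, p5, p6⟩ := m 0 1 (by decide)
  obtain ⟨q1, q2, q3, q4, q5, q6⟩ := m 0 2 (by decide)
  obtain ⟨r1, r2, r3, r4, r5, r6⟩ := m 1 2 (by decide)
  clear m main
  omega

theorem exists_meet_of_joinedIn (a b : Fin 3 → ℝ × ℝ) (F : Fin 3 → Fin 3 → Set (ℝ × ℝ))
    (hF : ∀ i j, JoinedIn (F i j) (a i) (b j)) :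
    ∃ i i' j j', i ≠ i' ∧ j ≠ j' ∧ (F i j ∩ F i' j').Nonempty := by
  have hc : Continuous fun p : ℝ × ℝ => Complex.equivRealProdCLM.symm p :=
    Complex.equivRealProdCLM.symm.continuous
  obtain ⟨i, i', j, j', hi, hj, _, ⟨s, rfl⟩, t, ht⟩ := exists_meet_of_paths_complex
    _ _ fun i j => (hF i j).somePath.map hc
  refine ⟨i, i', j, j', hi, hj, _, (hF i j).somePath_mem s, ?_⟩
  rw [← Complex.equivRealProdCLM.symm.injective ht]
  exact (hF i' j').somePath_mem t

end K33

namespace Drawing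

variable {V : Type*} {G : SimpleGraph V} (D : Drawing G)

theorem joinedIn_arcIm {u v : V} (h : G.Adj u v) :
    JoinedIn (D.arcIm ⟨s(u, v), h⟩) (D.pos u) (D.pos v) := by
  set e : G.edgeSet := ⟨s(u, v), h⟩ with he
  obtain ⟨x, y, hxy, h0, h1⟩ := D.arc_ends e
  have key : JoinedIn (D.arcIm e) (D.pos x) (D.pos y) := by
    rw [← h0, ← h1]
    exact (((convex_Icc (0 : ℝ) 1).isPathConnected ⟨0, by simp⟩).image' (D.arc_cont e)).joinedIn
      _ (mem_image_of_mem _ (by simp)) _ (mem_image_of_mem _ (by simp))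
  rcases Sym2.eq_iff.1 hxy with ⟨rfl, rfl⟩ | ⟨rfl, rfl⟩
  · exact key
  · exact key.symm

/-- The arc joining two adjacent vertices (and the empty set if they are not adjacent). -/
def edgeIm (u v : V) : Set (ℝ × ℝ) :=
  {p | ∃ h : G.Adj u v, p ∈ D.arcIm ⟨s(u, v), h⟩}

theorem joinedIn_edgeIm {u v : V} (h : G.Adj u v) :
    JoinedIn (D.edgeIm u v) (D.pos u) (D.pos v) :=
  (D.joinedIn_arcIm h).mono fun _ hp => ⟨h, hp⟩

/-- The arcs of the edges `uv` and `xy`, which have no common end, meet. -/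
structure Cross (u v x y : V) : Prop where
  adj₁ : G.Adj u v
  adj₂ : G.Adj x y
  ux : u ≠ x
  uy : u ≠ y
  vx : v ≠ x
  vy : v ≠ y
  meet : (D.edgeIm u v ∩ D.edgeIm x y).Nonempty

variable {D}

theorem Cross.symm {u v x y : V} (h : D.Cross u v x y) : D.Cross x y u v :=
  ⟨h.adj₂, h.adj₁, h.ux.symm, h.vx.symm, h.uy.symm, h.vy.symm, by
    rw [inter_comm]; exact h.meet⟩

theorem Cross.exists_crossing {u v x y : V} (h : D.Cross u v x y) :
    ∃ c ∈ D.crossings, c ∈ D.arcIm ⟨s(u, v), h.adj₁⟩ ∧ c ∈ D.arcIm ⟨s(x, y), h.adj₂⟩ := by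
  obtain ⟨c, ⟨_, h1⟩, ⟨_, h2⟩⟩ := h.meet
  refine ⟨c, ⟨?_, _, _, ?_, h1, h2⟩, h1, h2⟩
  · rintro ⟨w, rfl⟩
    have hw1 := not_imp_not.1 (D.no_vertex_interior ⟨s(u, v), h.adj₁⟩ w) h1
    have hw2 := not_imp_not.1 (D.no_vertex_interior ⟨s(x, y), h.adj₂⟩ w) h2
    simp only [Sym2.mem_iff] at hw1 hw2
    rcases hw1 with rfl | rfl <;> rcases hw2 with rfl | rfl
    exacts [h.ux rfl, h.uy rfl, h.vx rfl, h.vy rfl]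
  · intro he
    rcases Sym2.eq_iff.1 (Subtype.ext_iff.1 he) with ⟨h1, -⟩ | ⟨h1, -⟩
    exacts [h.ux h1, h.uy h1]

theorem IsNICPlanar.cross_eq_or [Finite V] [DecidableEq V] (hD : D.IsNICPlanar)
    {u v x y u' v' x' y' : V} (h : D.Cross u v x y) (h' : D.Cross u' v' x' y') :
    (s(u', v') = s(u, v) ∧ s(x', y') = s(x, y)) ∨ (s(u', v') = s(x, y) ∧ s(x', y') = s(u, v)) ∨
      (({u, v, x, y} : Finset V) ∩ {u', v', x', y'}).card ≤ 1 := by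
  obtain ⟨c, hc, h1, h2⟩ := h.exists_crossing
  obtain ⟨c', hc', h1', h2'⟩ := h'.exists_crossing
  have hne : s(u, v) ≠ s(x, y) := by
    intro he
    rcases Sym2.eq_iff.1 he with ⟨h1, -⟩ | ⟨h1, -⟩
    exacts [h.ux h1, h.uy h1]
  have hne' : s(u', v') ≠ s(x', y') := by
    intro he
    rcases Sym2.eq_iff.1 he with ⟨h1, -⟩ | ⟨h1, -⟩
    exacts [h'.ux h1, h'.uy h1]
  by_cases hcc : c = c'
  · subst hcc
    have k1 := D.at_most_two c hc.1 _ _ _ h1 h2 h1'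
    have k2 := D.at_most_two c hc.1 _ _ _ h1 h2 h2'
    rw [Subtype.ext_iff, Subtype.ext_iff, Subtype.ext_iff] at k1 k2
    dsimp only at k1 k2
    grind
  · refine Or.inr (Or.inr (le_trans ?_ (hD.2 c hc c' hc' hcc)))
    rw [← Set.ncard_coe_finset]
    refine Set.ncard_le_ncard ?_ (Set.toFinite _)
    intro w hw
    simp only [Finset.coe_inter, Finset.coe_insert, Finset.coe_singleton, mem_inter_iff,
      mem_insert_iff, mem_singleton_iff] at hw
    constructor
    · rcases hw.1 with rfl | rfl | rfl | rfl
      exacts [⟨_, h1, by simp⟩, ⟨_, h1, by simp⟩, ⟨_, h2, by simp⟩, ⟨_, h2, by simp⟩]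
    · rcases hw.2 with rfl | rfl | rfl | rfl
      exacts [⟨_, h1', by simp⟩, ⟨_, h1', by simp⟩, ⟨_, h2', by simp⟩, ⟨_, h2', by simp⟩]

variable (D)

/-- Every drawing of a subdivision of `K₃,₃` in which at most one edge is subdivided, and that
once, has a crossing of two of its edges. -/
theorem exists_cross_of_subdivision {a b : Fin 3 → V} {w : V}
    (ha : Function.Injective a) (hb : Function.Injective b) (P : V → V → Prop)
    (hadj : ∀ i j, ¬(i = 2 ∧ j = 2) → G.Adj (a i) (b j) ∧ P (a i) (b j))
    (hab : ∀ i j, a i ≠ b j)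
    (hwa : ∀ i, w ≠ a i) (hwb : ∀ j, w ≠ b j) (h1 : G.Adj (a 2) w ∧ P (a 2) w)
    (h2 : G.Adj w (b 2) ∧ P w (b 2)) :
    ∃ u v x y, D.Cross u v x y ∧ P u v ∧ P x y := by
  obtain ⟨i, i', j, j', hi, hj, c, hc, hc'⟩ := exists_meet_of_joinedIn (D.pos ∘ a) (D.pos ∘ b)
    (fun i j => if i = 2 ∧ j = 2 then D.edgeIm (a 2) w ∪ D.edgeIm w (b 2)
      else D.edgeIm (a i) (b j)) (by
      intro i j
      split_ifs with h
      · rw [h.1, h.2]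
        exact ((D.joinedIn_edgeIm h1.1).mono subset_union_left).trans
          ((D.joinedIn_edgeIm h2.1).mono subset_union_right)
      · exact D.joinedIn_edgeIm (hadj i j h).1)
  have key : ∀ i j, i ≠ 2 → j ≠ 2 → c ∈ D.edgeIm (a 2) w ∪ D.edgeIm w (b 2) →
      c ∈ D.edgeIm (a i) (b j) → ∃ u v x y, D.Cross u v x y ∧ P u v ∧ P x y := by
    intro i j hi hj hc hc'
    have hij := hadj i j (fun h => hi h.1)
    rcases hc with hc | hc
    · exact ⟨_, _, _, _, ⟨h1.1, hij.1, ha.ne hi.symm, hab _ _, hwa _, hwb _, c, hc, hc'⟩,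
        h1.2, hij.2⟩
    · exact ⟨_, _, _, _, ⟨h2.1, hij.1, hwa _, hwb _, (hab _ _).symm, hb.ne hj.symm, c, hc, hc'⟩,
        h2.2, hij.2⟩
  split_ifs at hc with hs
  · rw [if_neg (fun h => hi (hs.1.trans h.1.symm))] at hc'
    exact key i' j' (fun h => hi (hs.1.trans h.symm)) (fun h => hj (hs.2.trans h.symm)) hc hc'
  · split_ifs at hc' with hs'
    · exact key i j (fun h => hi (h.trans hs'.1.symm)) (fun h => hj (h.trans hs'.2.symm)) hc' hc
    · exact ⟨_, _, _, _, ⟨(hadj i j hs).1, (hadj i' j' hs').1, ha.ne hi, hab _ _, (hab _ _).symm,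
        hb.ne hj, c, hc, hc'⟩, (hadj i j hs).2, (hadj i' j' hs').2⟩

theorem exists_cross_of_subdivision_of_nodup {a₀ a₁ a₂ b₀ b₁ b₂ w : V}
    (hnd : [a₀, a₁, a₂, b₀, b₁, b₂, w].Nodup) (P : V → V → Prop)
    (h₀₀ : G.Adj a₀ b₀ ∧ P a₀ b₀) (h₀₁ : G.Adj a₀ b₁ ∧ P a₀ b₁) (h₀₂ : G.Adj a₀ b₂ ∧ P a₀ b₂)
    (h₁₀ : G.Adj a₁ b₀ ∧ P a₁ b₀) (h₁₁ : G.Adj a₁ b₁ ∧ P a₁ b₁) (h₁₂ : G.Adj a₁ b₂ ∧ P a₁ b₂)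
    (h₂₀ : G.Adj a₂ b₀ ∧ P a₂ b₀) (h₂₁ : G.Adj a₂ b₁ ∧ P a₂ b₁) (h₂ : G.Adj a₂ w ∧ P a₂ w)
    (h₂' : G.Adj w b₂ ∧ P w b₂) : ∃ u v x y, D.Cross u v x y ∧ P u v ∧ P x y := by
  simp only [List.nodup_cons, List.mem_cons, List.not_mem_nil, or_false, not_or,
    List.nodup_nil, and_true, not_false_eq_true] at hnd
  obtain ⟨⟨n1, n2, n3, n4, n5, n6⟩, ⟨n7, n8, n9, n10, n11⟩, ⟨n12, n13, n14, n15⟩, ⟨n16, n17, n18⟩,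
    ⟨n19, n20⟩, n21⟩ := hnd
  refine D.exists_cross_of_subdivision (a := ![a₀, a₁, a₂]) (b := ![b₀, b₁, b₂]) (w := w)
    ?_ ?_ P ?_ ?_ ?_ ?_ h₂ h₂'
  · intro i j
    fin_cases i <;> fin_cases j <;> simp [n1, n2, n7, Ne.symm n1, Ne.symm n2, Ne.symm n7]
  · intro i j
    fin_cases i <;> fin_cases j <;> simp [n16, n17, n19, Ne.symm n16, Ne.symm n17, Ne.symm n19]
  · intro i j
    fin_cases i <;> fin_cases j <;>
      simp [h₀₀, h₀₁, h₀₂, h₁₀, h₁₁, h₁₂, h₂₀, h₂₁]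
  · intro i j
    fin_cases i <;> fin_cases j <;> simp [n3, n4, n5, n8, n9, n10, n12, n13, n14]
  · intro i
    fin_cases i <;> simp [Ne.symm n6, Ne.symm n11, Ne.symm n15]
  · intro j
    fin_cases j <;> simp [Ne.symm n18, Ne.symm n20, Ne.symm n21]

theorem exists_cross {a b : Fin 3 → V} (ha : Function.Injective a) (hb : Function.Injective b)
    (hadj : ∀ i j, G.Adj (a i) (b j)) :
    ∃ i i' j j', i ≠ i' ∧ j ≠ j' ∧ D.Cross (a i) (b j) (a i') (b j') := by
  obtain ⟨i, i', j, j', hi, hj, h⟩ := exists_meet_of_joinedIn (D.pos ∘ a) (D.pos ∘ b)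
    (fun i j => D.edgeIm (a i) (b j)) fun i j => D.joinedIn_edgeIm (hadj i j)
  exact ⟨i, i', j, j', hi, hj, hadj i j, hadj i' j', ha.ne hi, (hadj i j').ne,
    (hadj i' j).ne.symm, hb.ne hj, h⟩

theorem exists_cross_finset {A B : Finset V} (hA : 3 ≤ A.card) (hB : 3 ≤ B.card)
    (hadj : ∀ a ∈ A, ∀ b ∈ B, G.Adj a b) :
    ∃ a ∈ A, ∃ a' ∈ A, ∃ b ∈ B, ∃ b' ∈ B, a ≠ a' ∧ b ≠ b' ∧ D.Cross a b a' b' := by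
  have key : ∀ S : Finset V, 3 ≤ S.card →
      ∃ f : Fin 3 → V, Function.Injective f ∧ ∀ i, f i ∈ S := by
    intro S hS
    obtain ⟨T, hT, hc⟩ := Finset.exists_subset_card_eq hS
    exact ⟨fun i => T.equivFin.symm (Fin.cast hc.symm i), fun i j h => by simpa using h,
      fun i => hT (Subtype.property _)⟩
  obtain ⟨f, hf, hfA⟩ := key A hA
  obtain ⟨g, hg, hgB⟩ := key B hB
  obtain ⟨i, i', j, j', hi, hj, h⟩ := D.exists_cross hf hg fun i j =>
    hadj _ (hfA i) _ (hgB j)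
  exact ⟨_, hfA i, _, hfA i', _, hgB j, _, hgB j', hf.ne hi, hg.ne hj, h⟩

variable [DecidableEq V]

/-- `S` consists of the ends of two edges without common end whose arcs meet. -/
def IsCluster (S : Finset V) : Prop :=
  ∃ u v x y, D.Cross u v x y ∧ S = {u, v, x, y}

variable {D}

theorem IsCluster.card_eq {S : Finset V} (h : D.IsCluster S) : S.card = 4 := by
  obtain ⟨u, v, x, y, h, rfl⟩ := h
  have := h.adj₁.ne
  have := h.adj₂.ne
  have := h.ux
  have := h.uy
  have := h.vx
  have := h.vy
  rw [Finset.card_insert_of_notMem (by simp [*]), Finset.card_insert_of_notMem (by simp [*]),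
    Finset.card_pair (by simp [*])]

theorem exists_isCluster (D : Drawing G) {A B : Finset V} (hA : 3 ≤ A.card) (hB : 3 ≤ B.card)
    (hadj : ∀ a ∈ A, ∀ b ∈ B, G.Adj a b) :
    ∃ S, D.IsCluster S ∧ S ⊆ A ∪ B ∧ (S ∩ A).card = 2 ∧ (S ∩ B).card = 2 := by
  obtain ⟨a, ha, a', ha', b, hb, b', hb', haa, hbb, h⟩ := D.exists_cross_finset hA hB hadj
  have hd : ∀ x, x ∈ A → x ∉ B := fun x hx hx' => (hadj x hx x hx').ne rfl
  have hd' : ∀ x, x ∈ B → x ∉ A := fun x hx hx' => (hadj x hx' x hx).ne rfl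
  refine ⟨{a, b, a', b'}, ⟨_, _, _, _, h, rfl⟩, ?_, ?_, ?_⟩
  · intro x
    simp only [Finset.mem_insert, Finset.mem_singleton, Finset.mem_union]
    rintro (rfl | rfl | rfl | rfl) <;> tauto
  · rw [← Finset.card_pair haa]
    congr 1
    ext x
    simp only [Finset.mem_inter, Finset.mem_insert, Finset.mem_singleton]
    constructor
    · rintro ⟨rfl | rfl | rfl | rfl, hx⟩
      exacts [Or.inl rfl, absurd hx (hd' _ hb), Or.inr rfl, absurd hx (hd' _ hb')]
    · rintro (rfl | rfl) <;> simp [*]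
  · rw [← Finset.card_pair hbb]
    congr 1
    ext x
    simp only [Finset.mem_inter, Finset.mem_insert, Finset.mem_singleton]
    constructor
    · rintro ⟨rfl | rfl | rfl | rfl, hx⟩
      exacts [absurd hx (hd _ ha), Or.inl rfl, absurd hx (hd _ ha'), Or.inr rfl]
    · rintro (rfl | rfl) <;> simp [*]

variable [Finite V]

theorem IsNICPlanar.card_inter_le (hD : D.IsNICPlanar) {S T : Finset V} (hS : D.IsCluster S)
    (hT : D.IsCluster T) (hne : S ≠ T) : (S ∩ T).card ≤ 1 := by
  obtain ⟨u, v, x, y, h, rfl⟩ := hS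
  obtain ⟨u', v', x', y', h', rfl⟩ := hT
  rcases hD.cross_eq_or h h' with h1 | h1 | h1
  · refine absurd ?_ hne
    ext w
    have e1 : w ∈ s(u', v') ↔ w ∈ s(u, v) := by rw [h1.1]
    have e2 : w ∈ s(x', y') ↔ w ∈ s(x, y) := by rw [h1.2]
    have e3 := (or_congr e1 e2).symm
    simpa only [Sym2.mem_iff, Finset.mem_insert, Finset.mem_singleton, or_assoc] using e3
  · refine absurd ?_ hne
    ext w
    have e1 : w ∈ s(u', v') ↔ w ∈ s(x, y) := by rw [h1.1]
    have e2 : w ∈ s(x', y') ↔ w ∈ s(u, v) := by rw [h1.2]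
    have e3 := ((or_congr e1 e2).trans or_comm).symm
    simpa only [Sym2.mem_iff, Finset.mem_insert, Finset.mem_singleton, or_assoc] using e3
  · exact h1

theorem IsNICPlanar.not_three_clusters (hD : D.IsNICPlanar) {W S T R : Finset V}
    (hW : W.card ≤ 7) (hS : D.IsCluster S) (hT : D.IsCluster T) (hR : D.IsCluster R)
    (hSW : S ⊆ W) (hTW : T ⊆ W) (hRW : R ⊆ W) (hST : S ≠ T) (hSR : S ≠ R) (hTR : T ≠ R) :
    False := by
  have h1 := hD.card_inter_le hS hT hST
  have h2 := hD.card_inter_le hS hR hSR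
  have h3 := hD.card_inter_le hT hR hTR
  have c1 := hS.card_eq
  have c2 := hT.card_eq
  have c3 := hR.card_eq
  have e1 := Finset.card_union_add_card_inter S T
  have e2 := Finset.card_union_add_card_inter (S ∪ T) R
  have e3 : ((S ∪ T) ∩ R).card ≤ (S ∩ R).card + (T ∩ R).card := by
    rw [Finset.union_inter_distrib_right]; exact Finset.card_union_le _ _
  have e4 := Finset.card_le_card
    (Finset.union_subset (Finset.union_subset hSW hTW) hRW)
  omega

end Drawing

namespace Drawing

variable {V : Type*} [DecidableEq V] [Finite V] {G : SimpleGraph V} {D : Drawing G}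

theorem IsNICPlanar.not_complete_three_five (hD : D.IsNICPlanar) {A B : Finset V}
    (hA : A.card = 3) (hB : B.card = 5) (hadj : ∀ a ∈ A, ∀ b ∈ B, G.Adj a b) : False := by
  obtain ⟨S, hS, -, hSA, hSB⟩ := exists_isCluster D (A := A) (B := B) (by omega) (by omega) hadj
  have hBS := Finset.card_sdiff_add_card_inter B S
  rw [Finset.inter_comm] at hBS
  obtain ⟨T, hT, hTs, hTA, hTB⟩ := exists_isCluster D (A := A) (B := B \ S) (by omega) (by omega)
    fun a ha b hb => hadj a ha b (Finset.sdiff_subset hb)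
  have meetA : ∀ S T : Finset V, (S ∩ A).card = 2 → (T ∩ A).card = 2 →
      1 ≤ (S ∩ T ∩ A).card := by
    intro S T h1 h2
    have := Finset.card_union_add_card_inter (S ∩ A) (T ∩ A)
    have h3 : (S ∩ A ∪ T ∩ A).card ≤ A.card :=
      Finset.card_le_card (Finset.union_subset Finset.inter_subset_right Finset.inter_subset_right)
    rw [← Finset.inter_inter_distrib_right] at this
    omega
  have hdAB : Disjoint A B := Finset.disjoint_left.2 fun x hx hx' => (hadj x hx x hx').ne rfl
  have disjB : ∀ S T : Finset V, D.IsCluster S → D.IsCluster T → (S ∩ A).card = 2 →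
      (T ∩ A).card = 2 → S ≠ T → Disjoint (S ∩ B) (T ∩ B) := by
    intro S T hS hT h1 h2 hne
    have h3 := hD.card_inter_le hS hT hne
    have h4 := meetA S T h1 h2
    have h5 : ((S ∩ T ∩ A) ∪ (S ∩ T ∩ B)).card ≤ (S ∩ T).card :=
      Finset.card_le_card (Finset.union_subset Finset.inter_subset_left Finset.inter_subset_left)
    rw [Finset.card_union_of_disjoint
      (hdAB.mono Finset.inter_subset_right Finset.inter_subset_right)] at h5
    rw [Finset.disjoint_iff_inter_eq_empty, ← Finset.inter_inter_distrib_right,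
      ← Finset.card_eq_zero]
    omega
  obtain ⟨x, hx⟩ : (S ∩ B).Nonempty := Finset.card_pos.1 (by omega)
  obtain ⟨y, hy⟩ : (T ∩ (B \ S)).Nonempty := Finset.card_pos.1 (by omega)
  have hST : S ≠ T := by rintro rfl; simp at hy
  have hyB : y ∈ T ∩ B := by simp at hy ⊢; tauto
  have hc : 3 ≤ (B \ {x, y}).card := by
    have h1 := Finset.le_card_sdiff {x, y} B
    have h2 := Finset.card_le_two (a := x) (b := y)
    omega
  obtain ⟨R, hR, hRs, hRA, hRB⟩ := exists_isCluster D (A := A) (B := B \ {x, y}) (by omega) hc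
    fun a ha b hb => hadj a ha b (Finset.sdiff_subset hb)
  have hnot : ∀ z ∈ B, z = x ∨ z = y → z ∉ R := by
    intro z hz hxy hzR
    have h1 := hRs hzR
    rcases Finset.mem_union.1 h1 with h1 | h1
    · exact Finset.disjoint_left.1 hdAB h1 hz
    · simp at h1; tauto
  have hSR : S ≠ R := by
    rintro rfl
    exact hnot x (Finset.mem_inter.1 hx).2 (Or.inl rfl) (Finset.mem_inter.1 hx).1
  have hTR : T ≠ R := by
    rintro rfl
    exact hnot y (Finset.mem_inter.1 hyB).2 (Or.inr rfl) (Finset.mem_inter.1 hyB).1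
  have d1 := disjB S T hS hT hSA hTA hST
  have d2 := disjB S R hS hR hSA hRA hSR
  have d3 := disjB T R hT hR hTA hRA hTR
  have g1 : (T ∩ (B \ S)).card ≤ (T ∩ B).card :=
    Finset.card_le_card (Finset.inter_subset_inter_left Finset.sdiff_subset)
  have g2 : (R ∩ (B \ {x, y})).card ≤ (R ∩ B).card :=
    Finset.card_le_card (Finset.inter_subset_inter_left Finset.sdiff_subset)
  have g3 : (S ∩ B ∪ T ∩ B ∪ R ∩ B).card ≤ B.card :=
    Finset.card_le_card (Finset.union_subset (Finset.union_subset Finset.inter_subset_right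
      Finset.inter_subset_right) Finset.inter_subset_right)
  rw [Finset.card_union_of_disjoint (Finset.disjoint_union_left.2 ⟨d2, d3⟩),
    Finset.card_union_of_disjoint d1] at g3
  omega

theorem IsNICPlanar.not_complete_three_three_one (hD : D.IsNICPlanar) {A B : Finset V} {c : V}
    (hA : A.card = 3) (hB : B.card = 3) (hadj : ∀ a ∈ A, ∀ b ∈ B, G.Adj a b)
    (hcA : ∀ a ∈ A, G.Adj c a) (hcB : ∀ b ∈ B, G.Adj c b) : False := by
  have hdAB : ∀ x ∈ A, x ∉ B := fun x hx hx' => (hadj x hx x hx').ne rfl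
  have hcA' : c ∉ A := fun h => (hcA c h).ne rfl
  have hcB' : c ∉ B := fun h => (hcB c h).ne rfl
  obtain ⟨S, hS, hSs, hSA, hSB⟩ := exists_isCluster D (A := A) (B := B) (by omega) (by omega) hadj
  obtain ⟨b, hb⟩ : (S ∩ B).Nonempty := Finset.card_pos.1 (by omega)
  rw [Finset.mem_inter] at hb
  obtain ⟨T, hT, hTs, hTA, -⟩ := exists_isCluster D (A := A) (B := insert c (B.erase b)) (by omega)
    (by rw [Finset.card_insert_of_notMem (by simp [hcB']), Finset.card_erase_of_mem hb.2]; omega)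
    (by
      intro a ha x hx
      rcases Finset.mem_insert.1 hx with rfl | hx
      · exact (hcA a ha).symm
      · exact hadj a ha x (Finset.mem_of_mem_erase hx))
  have hbT : b ∉ T := by
    intro h
    have h1 := hTs h
    simp only [Finset.mem_union, Finset.mem_insert, Finset.mem_erase] at h1
    rcases h1 with h1 | h1 | h1
    exacts [hdAB b h1 hb.2, hcB' (h1 ▸ hb.2), h1.1 rfl]
  obtain ⟨a, ha⟩ : (S ∩ A ∩ (T ∩ A)).Nonempty := by
    have := Finset.card_union_add_card_inter (S ∩ A) (T ∩ A)
    have h3 : (S ∩ A ∪ T ∩ A).card ≤ A.card :=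
      Finset.card_le_card (Finset.union_subset Finset.inter_subset_right Finset.inter_subset_right)
    exact Finset.card_pos.1 (by omega)
  simp only [Finset.mem_inter] at ha
  obtain ⟨R, hR, hRs, -, -⟩ := exists_isCluster D (A := B) (B := insert c (A.erase a)) (by omega)
    (by rw [Finset.card_insert_of_notMem (by simp [hcA']), Finset.card_erase_of_mem ha.1.2]; omega)
    (by
      intro b hb x hx
      rcases Finset.mem_insert.1 hx with rfl | hx
      · exact (hcB b hb).symm
      · exact (hadj x (Finset.mem_of_mem_erase hx) b hb).symm)
  have haR : a ∉ R := by
    intro h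
    have h1 := hRs h
    simp only [Finset.mem_union, Finset.mem_insert, Finset.mem_erase] at h1
    rcases h1 with h1 | h1 | h1
    exacts [hdAB a ha.1.2 h1, hcA' (h1 ▸ ha.1.2), h1.1 rfl]
  refine hD.not_three_clusters (W := insert c (A ∪ B)) ?_ hS hT hR ?_ ?_ ?_ ?_ ?_ ?_
  · have h1 := Finset.card_insert_le c (A ∪ B)
    have h2 := Finset.card_union_le A B
    omega
  · exact hSs.trans (Finset.subset_insert _ _)
  · intro x hx
    have := hTs hx
    simp only [Finset.mem_union, Finset.mem_insert, Finset.mem_erase] at this ⊢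
    tauto
  · intro x hx
    have := hRs hx
    simp only [Finset.mem_union, Finset.mem_insert, Finset.mem_erase] at this ⊢
    tauto
  · rintro rfl; exact hbT hb.1
  · rintro rfl; exact haR ha.1.1
  · rintro rfl; exact haR ha.2.1

/-- If the four vertices `p, q, r, s` are adjacent to each of `o, t, h`, and each of them is
adjacent to all but at most one of the others, then `op, tq` and `or, hs` cannot both cross. -/
theorem IsNICPlanar.not_cross_cross (hD : D.IsNICPlanar) {o t h p q r s : V}
    (hnd : [o, t, h, p, q, r, s].Nodup)
    (hadj : ∀ a ∈ [o, t, h], ∀ b ∈ [p, q, r, s], G.Adj a b)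
    (hq : ∀ x ∈ [p, r], G.Adj q s ∨ G.Adj q x)
    (h1 : D.Cross o p t q) (h2 : D.Cross o r h s) : False := by
  simp only [List.nodup_cons, List.mem_cons, List.not_mem_nil, or_false, not_or,
    List.nodup_nil, and_true, not_false_eq_true, ← ne_eq] at hnd
  obtain ⟨⟨ot, oh, op, oq, or', os⟩, ⟨th, tp, tq, tr, ts⟩, ⟨hp, hq', hr, hs⟩, ⟨pq, pr, ps⟩,
    ⟨qr, qs⟩, rs⟩ := hnd
  simp only [List.mem_cons, List.not_mem_nil, or_false, forall_eq_or_imp, forall_eq] at hadj hq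
  obtain ⟨⟨aop, aoq, aor, aos⟩, ⟨atp, atq, atr, ats⟩, ⟨ahp, ahq, ahr, ahs⟩⟩ := hadj
  set W : Finset V := {o, t, h, p, q, r, s} with hW
  have hWcard : W.card ≤ 7 := by
    have := List.toFinset_card_le [o, t, h, p, q, r, s]
    have e : W = [o, t, h, p, q, r, s].toFinset := by ext; simp [hW]
    rw [e]; exact this
  have W7 : o ∈ W ∧ t ∈ W ∧ h ∈ W ∧ p ∈ W ∧ q ∈ W ∧ r ∈ W ∧ s ∈ W := by simp [hW]
  clear_value W
  obtain ⟨wo, wt, wh, wp, wq, wr, ws⟩ := W7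
  have no_third : ∀ (e₁ e₂ : Sym2 V) (u v x y : V), (e₁ = s(o, p) ∨ e₁ = s(t, q)) →
      (e₂ = s(o, r) ∨ e₂ = s(h, s)) → D.Cross u v x y →
      (u ∈ W ∧ v ∈ W ∧ s(u, v) ≠ e₁ ∧ s(u, v) ≠ e₂) →
      (x ∈ W ∧ y ∈ W ∧ s(x, y) ≠ e₁ ∧ s(x, y) ≠ e₂) → False := by
    intro e₁ e₂ u v x y he₁ he₂ hc hu hx
    have c1 : (({o, p, t, q} : Finset V) ∩ {u, v, x, y}).card ≤ 1 := by
      rcases hD.cross_eq_or h1 hc with k | k | k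
      · rcases he₁ with rfl | rfl
        exacts [absurd k.1 hu.2.2.1, absurd k.2 hx.2.2.1]
      · rcases he₁ with rfl | rfl
        exacts [absurd k.2 hx.2.2.1, absurd k.1 hu.2.2.1]
      · exact k
    have c2 : (({o, r, h, s} : Finset V) ∩ {u, v, x, y}).card ≤ 1 := by
      rcases hD.cross_eq_or h2 hc with k | k | k
      · rcases he₂ with rfl | rfl
        exacts [absurd k.1 hu.2.2.2, absurd k.2 hx.2.2.2]
      · rcases he₂ with rfl | rfl
        exacts [absurd k.2 hx.2.2.2, absurd k.1 hu.2.2.2]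
      · exact k
    have k1 : D.IsCluster {o, p, t, q} := ⟨_, _, _, _, h1, rfl⟩
    have k2 : D.IsCluster {o, r, h, s} := ⟨_, _, _, _, h2, rfl⟩
    have k3 : D.IsCluster {u, v, x, y} := ⟨_, _, _, _, hc, rfl⟩
    refine hD.not_three_clusters hWcard k1 k2 k3 ?_ ?_ ?_ ?_ ?_ ?_
    · simp [Finset.insert_subset_iff, wo, wp, wt, wq]
    · simp [Finset.insert_subset_iff, wo, wr, wh, ws]
    · intro z
      rw [Finset.mem_insert, Finset.mem_insert, Finset.mem_insert, Finset.mem_singleton]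
      rintro (rfl | rfl | rfl | rfl)
      exacts [hu.1, hu.2.1, hx.1, hx.2.1]
    · intro e
      have : t ∈ ({o, r, h, s} : Finset V) := e ▸ (by simp)
      simp only [Finset.mem_insert, Finset.mem_singleton] at this
      rcases this with e | e | e | e
      exacts [ot e.symm, tr e, th e, ts e]
    · intro e
      rw [← e, Finset.inter_self, k1.card_eq] at c1
      omega
    · intro e
      rw [← e, Finset.inter_self, k2.card_eq] at c2
      omega
  have ne₁ : ∀ {u v x y : V}, u ≠ x → u ≠ y → s(u, v) ≠ s(x, y) := by
    intro u v x y h1 h2 h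
    rcases Sym2.eq_iff.1 h with h | h
    exacts [h1 h.1, h2 h.1]
  have ne₂ : ∀ {u v x y : V}, v ≠ x → v ≠ y → s(u, v) ≠ s(x, y) := by
    intro u v x y h1 h2
    rw [Sym2.eq_swap]
    exact ne₁ h1 h2
  by_cases hqs : G.Adj q s
  · obtain ⟨u, v, x, y, hc, hu, hx⟩ := D.exists_cross_of_subdivision_of_nodup (a₀ := o) (a₁ := h)
      (a₂ := t) (b₀ := p) (b₁ := r) (b₂ := q) (w := s) (by
        simp [oh, ot, op, or', aoq.ne, aos.ne, th.symm, ahp.ne, ahr.ne, ahq.ne, ahs.ne, atp.ne,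
          atr.ne, atq.ne, ats.ne, pr, pq, ps, qr.symm, rs, qs])
      (fun u v => u ∈ W ∧ v ∈ W ∧ s(u, v) ≠ s(t, q) ∧ s(u, v) ≠ s(h, s))
      ⟨aop, wo, wp, ne₁ ot oq, ne₁ oh os⟩ ⟨aor, wo, wr, ne₁ ot oq, ne₁ oh os⟩
      ⟨aoq, wo, wq, ne₁ ot oq, ne₁ oh os⟩
      ⟨ahp, wh, wp, ne₁ th.symm hq', ne₂ hp.symm ps⟩ ⟨ahr, wh, wr, ne₁ th.symm hq', ne₂ hr.symm rs⟩
      ⟨ahq, wh, wq, ne₁ th.symm hq', ne₂ hq'.symm qs⟩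
      ⟨atp, wt, wp, ne₂ tp.symm pq, ne₁ th ts⟩ ⟨atr, wt, wr, ne₂ tr.symm qr.symm, ne₁ th ts⟩
      ⟨ats, wt, ws, ne₂ ts.symm qs.symm, ne₁ th ts⟩
      ⟨hqs.symm, ws, wq, ne₁ ts.symm qs.symm, ne₂ hq'.symm qs⟩
    exact no_third _ _ u v x y (Or.inr rfl) (Or.inr rfl) hc hu hx
  · have aqp := hq.1.resolve_left hqs
    have aqr := hq.2.resolve_left hqs
    obtain ⟨u, v, x, y, hc, hu, hx⟩ := D.exists_cross_of_subdivision_of_nodup (a₀ := t) (a₁ := h)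
      (a₂ := q) (b₀ := p) (b₁ := r) (b₂ := s) (w := o) (by
        simp [th, tp, tq, tr, ts, hp, hq', hr, hs, pq.symm, ps, pr, qr, qs, rs, ot.symm, oh.symm,
          op.symm, oq.symm, or'.symm, os.symm])
      (fun u v => u ∈ W ∧ v ∈ W ∧ s(u, v) ≠ s(o, p) ∧ s(u, v) ≠ s(o, r))
      ⟨atp, wt, wp, ne₁ ot.symm tp, ne₁ ot.symm tr⟩ ⟨atr, wt, wr, ne₁ ot.symm tp, ne₁ ot.symm tr⟩
      ⟨ats, wt, ws, ne₁ ot.symm tp, ne₁ ot.symm tr⟩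
      ⟨ahp, wh, wp, ne₁ oh.symm hp, ne₁ oh.symm hr⟩ ⟨ahr, wh, wr, ne₁ oh.symm hp, ne₁ oh.symm hr⟩
      ⟨ahs, wh, ws, ne₁ oh.symm hp, ne₁ oh.symm hr⟩
      ⟨aqp, wq, wp, ne₁ oq.symm pq.symm, ne₁ oq.symm qr⟩
      ⟨aqr, wq, wr, ne₁ oq.symm pq.symm, ne₁ oq.symm qr⟩
      ⟨aoq.symm, wq, wo, ne₁ oq.symm pq.symm, ne₁ oq.symm qr⟩
      ⟨aos, wo, ws, ne₂ os.symm ps.symm, ne₂ os.symm rs.symm⟩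
    exact no_third _ _ u v x y (Or.inl rfl) (Or.inl rfl) hc hu hx

theorem IsNICPlanar.not_complete_three_two_two (hD : D.IsNICPlanar) {A B : Finset V}
    (hA : A.card = 3) (hB : B.card = 4) (hadj : ∀ a ∈ A, ∀ b ∈ B, G.Adj a b)
    (hadjB : ∀ q ∈ B, ∀ s ∈ B, ∀ x ∈ B, q ≠ s → q ≠ x → s ≠ x → G.Adj q s ∨ G.Adj q x) :
    False := by
  obtain ⟨b₀, hb₀⟩ : B.Nonempty := Finset.card_pos.1 (by omega)
  have herase : ∀ b ∈ B, 3 ≤ (B.erase b).card := by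
    intro b hb; rw [Finset.card_erase_of_mem hb]; omega
  have hdAB : ∀ x ∈ A, ∀ y ∈ B, x ≠ y := fun x hx y hy => (hadj x hx y hy).ne
  have base : ∀ b ∈ B, ∃ o ∈ A, ∃ t ∈ A, ∃ p ∈ B, ∃ q ∈ B, o ≠ t ∧ p ≠ q ∧ p ≠ b ∧ q ≠ b ∧
      D.Cross o p t q := by
    intro b hb
    obtain ⟨o, ho, t, ht, p, hp, q, hq, hot, hpq, h⟩ := D.exists_cross_finset (A := A)
      (B := B.erase b) (by omega) (herase b hb)
      fun a ha x hx => hadj a ha x (Finset.mem_of_mem_erase hx)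
    rw [Finset.mem_erase] at hp hq
    exact ⟨o, ho, t, ht, p, hp.2, q, hq.2, hot, hpq, hp.1, hq.1, h⟩
  obtain ⟨o, ho, t, ht, p, hp, q, hq, hot, hpq, -, -, h1⟩ := base b₀ hb₀
  obtain ⟨o', ho', h, hh, r, hr, s, hs, hoh, hrs, hrp, hsp, h2⟩ := base p hp
  -- the two crossings have a common vertex in `A`, which may be taken to be the first one of each
  have main : ∀ o ∈ A, ∀ t ∈ A, ∀ h ∈ A, ∀ p ∈ B, ∀ q ∈ B, ∀ r ∈ B, ∀ s ∈ B, o ≠ t → o ≠ h →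
      p ≠ q → r ≠ s → (r ≠ p ∧ s ≠ p ∨ r ≠ q ∧ s ≠ q) → D.Cross o p t q → D.Cross o r h s →
      False := by
    intro o ho t ht h hh p hp q hq r hr s hs hot hoh hpq hrs hne h1 h2
    have hle : (({o, p, t, q} : Finset V) ∩ {o, r, h, s}).card ≤ 1 := by
      refine hD.card_inter_le ⟨_, _, _, _, h1, rfl⟩ ⟨_, _, _, _, h2, rfl⟩ fun e => ?_
      have e1 : p ∈ ({o, r, h, s} : Finset V) := e ▸ (by simp)
      have e2 : q ∈ ({o, r, h, s} : Finset V) := e ▸ (by simp)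
      simp only [Finset.mem_insert, Finset.mem_singleton] at e1 e2
      have := hdAB o ho
      have := hdAB h hh
      grind
    have hout : ∀ z, z ∈ ({o, p, t, q} : Finset V) → z ∈ ({o, r, h, s} : Finset V) → z = o := by
      intro z hz hz'
      exact Finset.card_le_one.1 hle z (Finset.mem_inter.2 ⟨hz, hz'⟩) o (by simp)
    have hth : t ≠ h := fun e => hot (hout t (by simp) (by simp [e])).symm
    have hB' : ∀ z ∈ B, z ≠ o := fun z hz => (hdAB o ho z hz).symm
    have hpr : p ≠ r := fun e => hB' p hp (hout p (by simp) (by simp [e]))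
    have hps : p ≠ s := fun e => hB' p hp (hout p (by simp) (by simp [e]))
    have hqr : q ≠ r := fun e => hB' q hq (hout q (by simp) (by simp [e]))
    have hqs : q ≠ s := fun e => hB' q hq (hout q (by simp) (by simp [e]))
    refine hD.not_cross_cross (o := o) (t := t) (h := h) (p := p) (q := q) (r := r) (s := s)
      ?_ ?_ ?_ h1 h2
    · simp [hot, hoh, hth, hpq, hpr, hps, hqr, hqs, hrs, hdAB o ho p hp, hdAB o ho q hq,
        hdAB o ho r hr, hdAB o ho s hs, hdAB t ht p hp, hdAB t ht q hq, hdAB t ht r hr,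
        hdAB t ht s hs, hdAB h hh p hp, hdAB h hh q hq, hdAB h hh r hr, hdAB h hh s hs]
    · simp [hadj o ho p hp, hadj o ho q hq, hadj o ho r hr, hadj o ho s hs, hadj t ht p hp,
        hadj t ht q hq, hadj t ht r hr, hadj t ht s hs, hadj h hh p hp, hadj h hh q hq,
        hadj h hh r hr, hadj h hh s hs]
    · have h1 := hadjB q hq s hs p hp hqs hpq.symm hps.symm
      have h2 := hadjB q hq s hs r hr hqs hqr hrs.symm
      simp [h1, h2]
  have hcases : o = o' ∨ o = h ∨ t = o' ∨ t = h := by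
    by_contra! hcon
    have : ({o, t, o', h} : Finset V) ⊆ A := by
      intro z; simp only [Finset.mem_insert, Finset.mem_singleton]
      rintro (rfl | rfl | rfl | rfl) <;> assumption
    have h3 := Finset.card_le_card this
    rw [Finset.card_insert_of_notMem (by simp; tauto),
      Finset.card_insert_of_notMem (by simp; tauto), Finset.card_pair hoh] at h3
    omega
  rcases hcases with rfl | rfl | rfl | rfl
  · exact main o ho t ht h hh p hp q hq r hr s hs hot hoh hpq hrs (Or.inl ⟨hrp, hsp⟩) h1 h2
  · exact main o ho t ht o' ho' p hp q hq s hs r hr hot hoh.symm hpq hrs.symm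
      (Or.inl ⟨hsp, hrp⟩) h1 h2.symm
  · exact main t ht o ho h hh q hq p hp r hr s hs hot.symm hoh hpq.symm hrs (Or.inr ⟨hrp, hsp⟩)
      h1.symm h2
  · exact main t ht o ho o' ho' q hq p hp s hs r hr hot.symm hoh.symm hpq.symm hrs.symm
      (Or.inr ⟨hsp, hrp⟩) h1.symm h2.symm

end Drawing

/-- Twice the signed area of the triangle `abc`. -/
def orient {R : Type*} [Ring R] (a b c : R × R) : R :=
  (b.1 - a.1) * (c.2 - a.2) - (b.2 - a.2) * (c.1 - a.1)

theorem exists_eq_of_mem_segment {a b x : ℝ × ℝ} (h : x ∈ segment ℝ a b) :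
    ∃ t : ℝ, 0 ≤ t ∧ t ≤ 1 ∧ x = a + t • (b - a) := by
  rw [segment_eq_image'] at h
  obtain ⟨t, ht, rfl⟩ := h
  exact ⟨t, ht.1, ht.2, rfl⟩

theorem orient_add_smul (a b c d : ℝ × ℝ) (t : ℝ) :
    orient a b (c + t • (d - c)) = (1 - t) * orient a b c + t * orient a b d := by
  simp [orient]
  ring

theorem orient_eq_zero_of_mem_segment {a b x : ℝ × ℝ} (h : x ∈ segment ℝ a b) :
    orient a b x = 0 := by
  obtain ⟨t, -, -, rfl⟩ := exists_eq_of_mem_segment h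
  rw [orient_add_smul]
  simp only [orient]
  ring

theorem eq_of_mem_segment_of_mem_segment {a b c x : ℝ × ℝ} (h : orient a b c ≠ 0)
    (h₁ : x ∈ segment ℝ a b) (h₂ : x ∈ segment ℝ a c) : x = a := by
  have h0 := orient_eq_zero_of_mem_segment h₁
  obtain ⟨t, -, -, rfl⟩ := exists_eq_of_mem_segment h₂
  have ha : orient a b a = 0 := by simp [orient]
  rw [orient_add_smul, ha, mul_zero, zero_add] at h0
  simp [(mul_eq_zero.1 h0).resolve_right h]

theorem exists_param_of_meet {a b c d x : ℝ × ℝ} (hc : orient a b c ≠ 0) (hd : orient a b d ≠ 0)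
    (h₁ : x ∈ segment ℝ a b) (h₂ : x ∈ segment ℝ c d) :
    orient a b c * orient a b d < 0 ∧
      ∃ s : ℝ, 0 < s ∧ s < 1 ∧ x = c + s • (d - c) ∧
        s = orient a b c / (orient a b c - orient a b d) := by
  have h0 := orient_eq_zero_of_mem_segment h₁
  obtain ⟨s, hs0, hs1, rfl⟩ := exists_eq_of_mem_segment h₂
  rw [orient_add_smul] at h0
  have hs0' : 0 < s := hs0.lt_of_ne fun h => hc (by simpa [← h] using h0)
  have hs1' : s < 1 := hs1.lt_of_ne fun h => hd (by simpa [h] using h0)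
  have hneg : orient a b c * orient a b d < 0 := by
    have h1 : (1 - s) * (orient a b c * orient a b d) = -(s * (orient a b d * orient a b d)) := by
      linear_combination orient a b d * h0
    have h2 := mul_pos hs0' (mul_self_pos.2 hd)
    by_contra! h3
    nlinarith [mul_nonneg (sub_nonneg.2 hs1) h3]
  have hne : orient a b c - orient a b d ≠ 0 := by
    intro h
    rw [sub_eq_zero.1 h] at hneg
    exact absurd (mul_self_nonneg (orient a b d)) (not_le.2 hneg)
  exact ⟨hneg, s, hs0', hs1', rfl, by rw [eq_div_iff hne]; linear_combination -h0⟩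

/-- The affine frame at `z` with axes `u` and `v`, as a homeomorphism of the plane. -/
noncomputable def frameHomeomorph (z u v : ℝ × ℝ) (h : u.1 * v.2 - u.2 * v.1 ≠ 0) : ℝ × ℝ ≃ₜ ℝ × ℝ where
  toFun q := z + q.1 • u + q.2 • v
  invFun w := (((w.1 - z.1) * v.2 - (w.2 - z.2) * v.1) / (u.1 * v.2 - u.2 * v.1),
    (u.1 * (w.2 - z.2) - u.2 * (w.1 - z.1)) / (u.1 * v.2 - u.2 * v.1))
  left_inv q := by
    ext
    · simp only [Prod.fst_add, Prod.smul_fst, smul_eq_mul, Prod.snd_add, Prod.smul_snd]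
      rw [div_eq_iff h]; ring
    · simp only [Prod.fst_add, Prod.smul_fst, smul_eq_mul, Prod.snd_add, Prod.smul_snd]
      rw [div_eq_iff h]; ring
  right_inv w := by
    ext
    · simp only [Prod.fst_add, Prod.smul_fst, smul_eq_mul]
      generalize hΔ : u.1 * v.2 - u.2 * v.1 = Δ at h ⊢
      field_simp
      rw [← hΔ]
      ring
    · simp only [Prod.snd_add, Prod.smul_snd, smul_eq_mul]
      generalize hΔ : u.1 * v.2 - u.2 * v.1 = Δ at h ⊢
      field_simp
      rw [← hΔ]
      ring
  continuous_toFun := by fun_prop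
  continuous_invFun := by fun_prop

theorem frame_mem_segment_iff {a b v : ℝ × ℝ} {t ε x y : ℝ}
    (h : (b - a).1 * v.2 - (b - a).2 * v.1 ≠ 0) (ht : ε ≤ t) (ht' : ε ≤ 1 - t) (hε : 0 < ε)
    (hx : |x| < 1) :
    a + t • (b - a) + x • ε • (b - a) + y • ε • v ∈ segment ℝ a b ↔ y = 0 := by
  constructor
  · intro hy
    have h0 := orient_eq_zero_of_mem_segment hy
    have : y * (ε * ((b - a).1 * v.2 - (b - a).2 * v.1)) = 0 := by
      rw [← h0]
      simp [orient]
      ring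
    exact (mul_eq_zero.1 this).resolve_right (mul_ne_zero hε.ne' h)
  · rintro rfl
    rw [segment_eq_image']
    obtain ⟨h1, h2⟩ := abs_lt.1 hx
    refine ⟨t + x * ε, ⟨by nlinarith, by nlinarith⟩, ?_⟩
    simp only [zero_smul, add_zero]
    module

theorem properCross_segment {a b c d z : ℝ × ℝ} {t s : ℝ}
    (h : (b - a).1 * (d - c).2 - (b - a).2 * (d - c).1 ≠ 0) (ht0 : 0 < t) (ht1 : t < 1)
    (hs0 : 0 < s) (hs1 : s < 1) (hz : z = a + t • (b - a)) (hz' : z = c + s • (d - c)) :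
    ProperCross (segment ℝ a b) (segment ℝ c d) z := by
  obtain ⟨ε, hε, h1, h2, h3, h4⟩ :
      ∃ ε : ℝ, 0 < ε ∧ ε ≤ t ∧ ε ≤ 1 - t ∧ ε ≤ s ∧ ε ≤ 1 - s :=
    ⟨min (min t (1 - t)) (min s (1 - s)), by simp [*], by simp, by simp, by simp, by simp⟩
  have hdet : (ε • (b - a)).1 * (ε • (d - c)).2 - (ε • (b - a)).2 * (ε • (d - c)).1 ≠ 0 := by
    have : (ε • (b - a)).1 * (ε • (d - c)).2 - (ε • (b - a)).2 * (ε • (d - c)).1 =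
      ε * ε * ((b - a).1 * (d - c).2 - (b - a).2 * (d - c).1) := by simp; ring
    rw [this]
    positivity
  set ψ := frameHomeomorph z (ε • (b - a)) (ε • (d - c)) hdet with hψ
  have hψ' : ∀ q : ℝ × ℝ, ψ q = z + q.1 • ε • (b - a) + q.2 • ε • (d - c) := fun q => rfl
  let Φ : ℝ × ℝ ≃ₜ ψ '' Metric.ball (0 : ℝ × ℝ) 1 :=
    Homeomorph.unitBall.trans (ψ.image (Metric.ball 0 1))
  have hΦ : ∀ q : ℝ × ℝ, ∃ r : ℝ, r ≠ 0 ∧ |r * q.1| < 1 ∧ |r * q.2| < 1 ∧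
      (Φ q : ℝ × ℝ) = ψ (r * q.1, r * q.2) := by
    intro q
    have hq : ((Homeomorph.unitBall q : Metric.ball (0 : ℝ × ℝ) 1) : ℝ × ℝ) =
        (√(1 + ‖q‖ ^ 2))⁻¹ • q := rfl
    have hlt := (Homeomorph.unitBall q : Metric.ball (0 : ℝ × ℝ) 1).2
    rw [mem_ball_zero_iff, hq, Prod.norm_def, max_lt_iff] at hlt
    exact ⟨_, inv_ne_zero (by positivity), hlt.1, hlt.2, congrArg ψ hq⟩
  have h0 : ((0, 0) : ℝ × ℝ) ∈ Metric.ball (0 : ℝ × ℝ) 1 := by simp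
  have hz0 : ψ (0, 0) = z := by simp [hψ']
  refine ⟨ψ '' Metric.ball 0 1, ψ.isOpenMap _ Metric.isOpen_ball, ⟨_, h0, hz0⟩, Φ.symm, ?_, ?_, ?_⟩
  · rw [Homeomorph.symm_apply_eq]
    obtain ⟨r, -, -, -, hr⟩ := hΦ (0, 0)
    apply Subtype.ext
    rw [hr]
    simp [hz0]
  · ext q
    obtain ⟨r, hr, hr1, hr2, hq⟩ := hΦ q
    have key := frame_mem_segment_iff (x := r * q.1) (y := r * q.2) h h1 h2 hε hr1
    rw [← hz, ← hψ' (r * q.1, r * q.2), ← hq, mul_eq_zero, or_iff_right hr] at key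
    rw [mem_ofPred_eq, ← key]
    constructor
    · rintro ⟨x, hx, rfl⟩
      simpa using hx
    · exact fun hx => ⟨Φ q, hx, by simp⟩
  · ext q
    obtain ⟨r, hr, hr1, hr2, hq⟩ := hΦ q
    have h' : (d - c).1 * (b - a).2 - (d - c).2 * (b - a).1 ≠ 0 := by
      intro h0; exact h (by linear_combination -h0)
    have key := frame_mem_segment_iff (x := r * q.2) (y := r * q.1) h' h3 h4 hε hr2
    rw [← hz', add_right_comm, ← hψ' (r * q.1, r * q.2), ← hq, mul_eq_zero, or_iff_right hr] at key
    rw [mem_ofPred_eq, ← key]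
    constructor
    · rintro ⟨x, hx, rfl⟩
      simpa using hx
    · exact fun hx => ⟨Φ q, hx, by simp⟩

theorem properCross_segment_of_meet {a b c d z : ℝ × ℝ} (hc : orient a b c ≠ 0)
    (hd : orient a b d ≠ 0) (ha : orient c d a ≠ 0) (hb : orient c d b ≠ 0)
    (h₁ : z ∈ segment ℝ a b) (h₂ : z ∈ segment ℝ c d) :
    ProperCross (segment ℝ a b) (segment ℝ c d) z := by
  obtain ⟨hneg, s, hs0, hs1, hs, -⟩ := exists_param_of_meet hc hd h₁ h₂
  obtain ⟨-, t, ht0, ht1, ht, -⟩ := exists_param_of_meet ha hb h₂ h₁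
  refine properCross_segment ?_ ht0 ht1 hs0 hs1 ht hs
  intro h
  have : orient a b c = orient a b d := by
    simp only [orient, Prod.fst_sub, Prod.snd_sub] at h ⊢
    linear_combination -h
  rw [this] at hneg
  exact absurd (mul_self_nonneg (orient a b d)) (not_le.2 hneg)

theorem Sym2.exists_disjoint {V : Type*} (e f : Sym2 V) :
    (∃ v, v ∈ e ∧ v ∈ f) ∨
      ∃ a b c d, e = s(a, b) ∧ f = s(c, d) ∧ c ≠ a ∧ c ≠ b ∧ d ≠ a ∧ d ≠ b := by
  induction e with | _ a b
  induction f with | _ c d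
  by_cases h : ∃ v, v ∈ s(a, b) ∧ v ∈ s(c, d)
  · exact Or.inl h
  · simp only [Sym2.mem_iff, not_exists, not_and, not_or] at h
    refine Or.inr ⟨a, b, c, d, rfl, rfl, ?_⟩
    have h1 := h a (Or.inl rfl)
    have h2 := h b (Or.inr rfl)
    exact ⟨Ne.symm h1.1, Ne.symm h2.1, Ne.symm h1.2, Ne.symm h2.2⟩

section StraightLine

variable {V : Type*} {G : SimpleGraph V}

/-- The straight segment joining the ends of the edge `e`, parametrised by `[0, 1]`. -/
noncomputable def segArc (p : V → ℝ × ℝ) (e : G.edgeSet) (t : ℝ) : ℝ × ℝ :=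
  AffineMap.lineMap (p (Quot.out (e : Sym2 V)).1) (p (Quot.out (e : Sym2 V)).2) t

theorem segArc_image (p : V → ℝ × ℝ) (e : G.edgeSet) {a b : V} (h : (e : Sym2 V) = s(a, b)) :
    segArc p e '' Icc 0 1 = segment ℝ (p a) (p b) := by
  have h1 : s((Quot.out (e : Sym2 V)).1, (Quot.out (e : Sym2 V)).2) = s(a, b) := by
    rw [← h]; exact Quot.out_eq _
  have h2 : segArc p e '' Icc 0 1 =
      segment ℝ (p (Quot.out (e : Sym2 V)).1) (p (Quot.out (e : Sym2 V)).2) :=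
    (segment_eq_image_lineMap ℝ _ _).symm
  rw [h2]
  rcases Sym2.eq_iff.1 h1 with ⟨h3, h4⟩ | ⟨h3, h4⟩
  · rw [h3, h4]
  · rw [h3, h4, segment_symm]

theorem segArc_inter_subset {p : V → ℝ × ℝ}
    (hp : ∀ a b c, G.Adj a b → c ≠ a → c ≠ b → orient (p a) (p b) (p c) ≠ 0)
    {e f : G.edgeSet} (hef : e ≠ f) {v : V} (he : v ∈ (e : Sym2 V))
    (hf : v ∈ (f : Sym2 V)) : segArc p e '' Icc 0 1 ∩ segArc p f '' Icc 0 1 ⊆ {p v} := by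
  obtain ⟨b, hb⟩ := Sym2.mem_iff_exists.1 he
  obtain ⟨c, hc⟩ := Sym2.mem_iff_exists.1 hf
  have hvb : G.Adj v b := by have := e.2; rwa [hb] at this
  have hvc : G.Adj v c := by have := f.2; rwa [hc] at this
  have hbc : c ≠ b := by rintro rfl; exact hef (Subtype.ext (hb.trans hc.symm))
  rw [segArc_image p e hb, segArc_image p f hc]
  exact fun x hx => eq_of_mem_segment_of_mem_segment (hp v b c hvb hvc.ne.symm hbc) hx.1 hx.2

theorem exists_of_segArc_meet {p : V → ℝ × ℝ}
    (hp : ∀ a b c, G.Adj a b → c ≠ a → c ≠ b → orient (p a) (p b) (p c) ≠ 0)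
    {e f : G.edgeSet} (hef : e ≠ f) {x : ℝ × ℝ}
    (hx : x ∉ range p) (he : x ∈ segArc p e '' Icc 0 1) (hf : x ∈ segArc p f '' Icc 0 1) :
    ∃ a b c d, (e : Sym2 V) = s(a, b) ∧ (f : Sym2 V) = s(c, d) ∧ G.Adj a b ∧ G.Adj c d ∧
      orient (p a) (p b) (p c) ≠ 0 ∧ orient (p a) (p b) (p d) ≠ 0 ∧
      orient (p c) (p d) (p a) ≠ 0 ∧ orient (p c) (p d) (p b) ≠ 0 := by
  rcases Sym2.exists_disjoint (e : Sym2 V) f with ⟨v, h1, h2⟩ | ⟨a, b, c, d, h1, h2, ca, cb, da, db⟩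
  · exact absurd ⟨v, (segArc_inter_subset hp hef h1 h2 ⟨he, hf⟩).symm⟩ hx
  · have hab : G.Adj a b := by have := e.2; rwa [h1] at this
    have hcd : G.Adj c d := by have := f.2; rwa [h2] at this
    exact ⟨a, b, c, d, h1, h2, hab, hcd, hp _ _ _ hab ca cb, hp _ _ _ hab da db,
      hp _ _ _ hcd ca.symm da.symm, hp _ _ _ hcd cb.symm db.symm⟩

theorem segArc_inter_subsingleton {p : V → ℝ × ℝ}
    (hp : ∀ a b c, G.Adj a b → c ≠ a → c ≠ b → orient (p a) (p b) (p c) ≠ 0)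
    {e f : G.edgeSet} (hef : e ≠ f) :
    (segArc p e '' Icc 0 1 ∩ segArc p f '' Icc 0 1).Subsingleton := by
  rcases Sym2.exists_disjoint (e : Sym2 V) f with ⟨v, h1, h2⟩ | ⟨a, b, c, d, h1, h2, ca, cb, da, db⟩
  · exact subsingleton_singleton.anti (segArc_inter_subset hp hef h1 h2)
  · have hab : G.Adj a b := by have := e.2; rwa [h1] at this
    rw [segArc_image p e h1, segArc_image p f h2]
    rintro x ⟨hx1, hx2⟩ y ⟨hy1, hy2⟩
    obtain ⟨-, s, -, -, rfl, rfl⟩ :=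
      exists_param_of_meet (hp _ _ _ hab ca cb) (hp _ _ _ hab da db) hx1 hx2
    obtain ⟨-, s, -, -, rfl, rfl⟩ :=
      exists_param_of_meet (hp _ _ _ hab ca cb) (hp _ _ _ hab da db) hy1 hy2
    rfl

/-- A straight-line placement of the vertices with no vertex on the line through an edge gives an
NIC-planar drawing, provided that each edge is crossed at most once (`X` being a relation that
contains all pairs of crossing edges) and that the ends of two pairs of crossing edges share at
most one vertex. -/
theorem nicPlanar_of_straight {p : V → ℝ × ℝ}
    (hp : ∀ a b c, G.Adj a b → c ≠ a → c ≠ b → orient (p a) (p b) (p c) ≠ 0)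
    (hinj : Function.Injective p) {X : Sym2 V → Sym2 V → Prop}
    (hX : ∀ a b c d, G.Adj a b → G.Adj c d →
      orient (p a) (p b) (p c) * orient (p a) (p b) (p d) < 0 →
      orient (p c) (p d) (p a) * orient (p c) (p d) (p b) < 0 → X s(a, b) s(c, d))
    (h₁ : ∀ e f f', X e f → X e f' → f = f')
    (h₂ : ∀ e f e' f', X e f → X e' f' → (e' = e ∨ e' = f) ∨
      ∀ x y, (x ∈ e ∨ x ∈ f) → (x ∈ e' ∨ x ∈ f') → (y ∈ e ∨ y ∈ f) → (y ∈ e' ∨ y ∈ f') → x = y) :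
    G.NICPlanar := by
  have hcross : ∀ e f : G.edgeSet, e ≠ f → ∀ x, x ∉ range p → x ∈ segArc p e '' Icc 0 1 →
      x ∈ segArc p f '' Icc 0 1 → X e f := by
    intro e f hef x hx he hf
    obtain ⟨a, b, c, d, h1, h2, hab, hcd, hc, hd, ha, hb⟩ := exists_of_segArc_meet hp hef hx he hf
    rw [segArc_image p e h1] at he
    rw [segArc_image p f h2] at hf
    rw [h1, h2]
    exact hX a b c d hab hcd (exists_param_of_meet hc hd he hf).1
      (exists_param_of_meet ha hb hf he).1
  let D : Drawing G :=
    { pos := p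
      pos_inj := hinj
      arc := segArc p
      arc_cont := fun e => (AffineMap.lineMap_continuous).continuousOn
      arc_inj := by
        intro e
        refine (AffineMap.lineMap_injective ℝ (hinj.ne ?_)).injOn
        intro h
        have h1 : (e : Sym2 V) = s((Quot.out (e : Sym2 V)).1, (Quot.out (e : Sym2 V)).2) :=
          (Quot.out_eq _).symm
        have h2 := e.2
        rw [h1, SimpleGraph.mem_edgeSet] at h2
        exact h2.ne h
      arc_ends := fun e => ⟨_, _, (Quot.out_eq _).symm, AffineMap.lineMap_apply_zero _ _,
        AffineMap.lineMap_apply_one _ _⟩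
      no_vertex_interior := by
        rintro ⟨e, he⟩ v hv
        induction e with | _ a b
        rw [segArc_image p _ rfl]
        simp only [Sym2.mem_iff, not_or] at hv
        exact fun h => hp a b v he hv.1 hv.2 (orient_eq_zero_of_mem_segment h)
      shared_endpoint := fun e f hef v he hf => segArc_inter_subset hp hef he hf
      finite_meet := fun e f hef => (segArc_inter_subsingleton hp hef).finite
      proper := by
        rintro e f hef x ⟨he, hf⟩ hx
        obtain ⟨a, b, c, d, h1, h2, hab, hcd, hc, hd, ha, hb⟩ :=
          exists_of_segArc_meet hp hef hx he hf
        rw [segArc_image p e h1] at he ⊢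
        rw [segArc_image p f h2] at hf ⊢
        exact properCross_segment_of_meet hc hd ha hb he hf
      at_most_two := by
        intro x hx e f g he hf hg
        by_contra! h
        exact h.2.2 (Subtype.ext (h₁ _ _ _ (hcross e f h.1 x hx he hf)
          (hcross e g h.2.1 x hx he hg))) }
  have hone : D.IsOnePlanar := by
    have key : ∀ e : G.edgeSet, ∀ c ∈ D.crossings, c ∈ D.arcIm e →
        ∃ f, e ≠ f ∧ c ∈ D.arcIm f ∧ X e f := by
      rintro e c ⟨hc, f, g, hfg, hf, hg⟩ he
      by_cases hef : e = f
      · subst hef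
        exact ⟨g, hfg, hg, hcross e g hfg c hc he hg⟩
      · exact ⟨f, hef, hf, hcross e f hef c hc he hf⟩
    rintro e c ⟨hc, hce⟩ c' ⟨hc', hce'⟩
    obtain ⟨f, hef, hf, hX⟩ := key e c hc hce
    obtain ⟨f', -, hf', hX'⟩ := key e c' hc' hce'
    obtain rfl : f = f' := Subtype.ext (h₁ _ _ _ hX hX')
    exact segArc_inter_subsingleton hp hef ⟨hce, hf⟩ ⟨hce', hf'⟩
  refine ⟨D, hone, ?_⟩
  rintro c ⟨hc, e, f, hef, he, hf⟩ c' ⟨hc', e', f', hef', he', hf'⟩ hcc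
  have hcl : ∀ {c : ℝ × ℝ} {e f : G.edgeSet} {v : V}, c ∉ range p → e ≠ f → c ∈ D.arcIm e →
      c ∈ D.arcIm f → v ∈ D.cluster c → v ∈ (e : Sym2 V) ∨ v ∈ (f : Sym2 V) := by
    rintro c e f v hc hef he hf ⟨g, hg, hv⟩
    rcases D.at_most_two c hc e f g he hf hg with h | h | h
    exacts [absurd h hef, Or.inl (h ▸ hv), Or.inr (h ▸ hv)]
  rcases h₂ _ _ _ _ (hcross e f hef c hc he hf) (hcross e' f' hef' c' hc' he' hf') with
    (h | h) | h
  · obtain rfl := Subtype.ext h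
    exact absurd (hone _ ⟨⟨hc, e', f, hef, he, hf⟩, he⟩ ⟨⟨hc', e', f', hef', he', hf'⟩, he'⟩) hcc
  · obtain rfl := Subtype.ext h
    exact absurd (hone _ ⟨⟨hc, e, e', hef, he, hf⟩, hf⟩ ⟨⟨hc', e', f', hef', he', hf'⟩, he'⟩) hcc
  · have hsub : (D.cluster c ∩ D.cluster c').Subsingleton := fun x hx y hy =>
      h x y (hcl hc hef he hf hx.1) (hcl hc' hef' he' hf' hx.2) (hcl hc hef he hf hy.1)
        (hcl hc' hef' he' hf' hy.2)
    exact ncard_le_one hsub.finite |>.2 hsub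

theorem nicPlanar_of_int_straight {ι : Type*} {f : V → ι} (hf : Function.Injective f)
    (A : ι → ι → Prop) (hA : ∀ a b, G.Adj a b → A (f a) (f b)) (q : ι → ℤ × ℤ)
    (hq : Function.Injective q) (X : Sym2 ι → Sym2 ι → Prop)
    (hp : ∀ a b c, A a b → c ≠ a → c ≠ b → orient (q a) (q b) (q c) ≠ 0)
    (hX : ∀ a b c d, A a b → A c d →
      orient (q a) (q b) (q c) * orient (q a) (q b) (q d) < 0 →
      orient (q c) (q d) (q a) * orient (q c) (q d) (q b) < 0 → X s(a, b) s(c, d))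
    (h₁ : ∀ e f f', X e f → X e f' → f = f')
    (h₂ : ∀ e f e' f', X e f → X e' f' → (e' = e ∨ e' = f) ∨
      ∀ x y, (x ∈ e ∨ x ∈ f) → (x ∈ e' ∨ x ∈ f') → (y ∈ e ∨ y ∈ f) → (y ∈ e' ∨ y ∈ f') → x = y) :
    G.NICPlanar := by
  let c : ℤ × ℤ → ℝ × ℝ := fun z => (z.1, z.2)
  have hc : ∀ x y z, orient (c x) (c y) (c z) = (orient x y z : ℤ) := by
    intro x y z
    simp [orient, c]
  have hcinj : Function.Injective c := by
    rintro ⟨x, y⟩ ⟨x', y'⟩ h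
    simpa [c] using h
  have hinj := Sym2.map.injective hf
  refine nicPlanar_of_straight (p := fun v => c (q (f v))) ?_ (hcinj.comp (hq.comp hf))
    (X := fun e e' => X (e.map f) (e'.map f)) ?_ ?_ ?_
  · intro x y z hxy hx hy
    rw [hc]
    exact_mod_cast hp _ _ _ (hA _ _ hxy) (hf.ne hx) (hf.ne hy)
  · intro x y z w hxy hzw h h'
    simp only [hc] at h h'
    exact hX _ _ _ _ (hA _ _ hxy) (hA _ _ hzw) (by exact_mod_cast h) (by exact_mod_cast h')
  · exact fun e e' e'' h h' => hinj (h₁ _ _ _ h h')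
  · intro e g e' g' h h'
    refine (h₂ _ _ _ _ h h').imp (Or.imp (fun h => hinj h) fun h => hinj h) ?_
    intro H x y h1 h2 h3 h4
    have hm : ∀ {x : V} {e : Sym2 V}, x ∈ e → f x ∈ e.map f := fun h =>
      Sym2.mem_map.2 ⟨_, h, rfl⟩
    exact hf (H _ _ (h1.imp hm hm) (h2.imp hm hm) (h3.imp hm hm) (h4.imp hm hm))

end StraightLine

theorem sigma_fin_ext {k : ℕ} {a : Fin k → ℕ} {v w : Σ i : Fin k, Fin (a i)} (h : v.1 = w.1)
    (h' : (v.2 : ℕ) = w.2) : v = w := by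
  obtain ⟨i, x⟩ := v
  obtain ⟨j, y⟩ := w
  obtain rfl : i = j := h
  exact congrArg _ (Fin.ext h')

/-- `K_{a,1,1}`: the `a` vertices on a line, the two others on either side of it. -/
theorem nicPlanar_completeMultipartite_one_one (a : ℕ) :
    (completeMultipartite ![a, 1, 1]).NICPlanar := by
  refine nicPlanar_of_int_straight (ι := ℕ)
    (f := fun v => ![2, 0, 1] v.1 + v.2) ?_ (fun x y => x ≠ y ∧ (x < 2 ∨ y < 2)) ?_
    (fun n => if n = 0 then (0, 1) else if n = 1 then (0, -1) else ((n : ℤ) - 1, 0)) ?_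
    (fun _ _ => False) ?_ ?_ (by simp) (by simp)
  · rintro ⟨i, k⟩ ⟨j, l⟩ h
    have hk := k.2
    have hl := l.2
    have hij : i = j := by
      fin_cases i <;> fin_cases j <;> first | rfl | (exfalso; simp at h hk hl; omega)
    subst hij
    exact sigma_fin_ext rfl (by simpa using h)
  · rintro ⟨i, k⟩ ⟨j, l⟩ h
    have := k.2
    have := l.2
    fin_cases i <;> fin_cases j <;> simp_all <;> omega
  · intro x y h
    simp only at h
    split_ifs at h <;> simp_all
  · intro x y z ⟨hxy, h⟩ hx hy
    simp only [orient]
    split_ifs <;> simp_all <;> omega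
  · intro x y z w ⟨hxy, h⟩ ⟨hzw, h'⟩ h1 h2
    simp only [orient] at h1 h2
    split_ifs at h1 h2 <;> simp_all [mul_neg_iff, mul_pos_iff] <;> omega

theorem nicPlanar_completeMultipartite_two_one {a : ℕ} (ha : a ≤ 4) :
    (completeMultipartite ![a, 2, 1]).NICPlanar := by
  have hlt : ∀ v : Σ i, Fin (![a, 2, 1] i), ![0, 4, 6] v.1 + (v.2 : ℕ) < 7 := by
    rintro ⟨i, k⟩
    have := k.2
    fin_cases i <;> simp_all <;> omega
  refine nicPlanar_of_int_straight (ι := Fin 7)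
    (f := fun v => ⟨![0, 4, 6] v.1 + v.2, hlt v⟩) ?_
    (fun x y => (![0, 0, 0, 0, 1, 1, 2] : Fin 7 → ℕ) x ≠ ![0, 0, 0, 0, 1, 1, 2] y) ?_
    ![(-6, -3), (2, 3), (-4, -3), (8, 6), (1, -8), (-8, 6), (-3, 0)] (by decide)
    (fun e f => (e = s(0, 6) ∧ f = s(2, 5)) ∨ (e = s(2, 5) ∧ f = s(0, 6)) ∨
      (e = s(1, 4) ∧ f = s(3, 6)) ∨ (e = s(3, 6) ∧ f = s(1, 4)))
    (by decide +kernel) (by decide +kernel) ?_ ?_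
  · rintro ⟨i, k⟩ ⟨j, l⟩ h
    have hk := k.2
    have hl := l.2
    have hij : i = j := by
      fin_cases i <;> fin_cases j <;> first | rfl | (exfalso; simp at h hk hl; omega)
    subst hij
    exact sigma_fin_ext rfl (by simpa using h)
  · have key : ∀ v : Σ i, Fin (![a, 2, 1] i),
        (![0, 0, 0, 0, 1, 1, 2] : Fin 7 → ℕ) ⟨![0, 4, 6] v.1 + v.2, hlt v⟩ = v.1 := by
      rintro ⟨i, k⟩
      have hk := k.2
      obtain ⟨k, hk'⟩ := k
      fin_cases i
      · have : k < 4 := by simp at hk; omega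
        interval_cases k <;> rfl
      · have : k < 2 := by simpa using hk
        interval_cases k <;> rfl
      · have : k < 1 := by simpa using hk
        interval_cases k; rfl
    intro v w h
    rw [key, key]
    exact fun h' => h (Fin.ext h')
  · rintro e f f' (⟨rfl, rfl⟩ | ⟨rfl, rfl⟩ | ⟨rfl, rfl⟩ | ⟨rfl, rfl⟩) <;> decide +revert
  · rintro e f e' f' (⟨rfl, rfl⟩ | ⟨rfl, rfl⟩ | ⟨rfl, rfl⟩ | ⟨rfl, rfl⟩)
      (⟨rfl, rfl⟩ | ⟨rfl, rfl⟩ | ⟨rfl, rfl⟩ | ⟨rfl, rfl⟩) <;> simp only [Sym2.mem_iff] <;> decide +kernel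

theorem nicPlanar_completeMultipartite_two_two :
    (completeMultipartite ![2, 2, 2]).NICPlanar := by
  have hlt : ∀ v : Σ i, Fin (![2, 2, 2] i), (v.1 : ℕ) + 3 * (v.2 : ℕ) < 6 := by
    rintro ⟨i, k⟩
    have := k.2
    fin_cases i <;> simp_all <;> omega
  refine nicPlanar_of_int_straight (ι := Fin 6)
    (f := fun v => ⟨v.1 + 3 * v.2, hlt v⟩) ?_
    (fun x y => (x : ℕ) % 3 ≠ (y : ℕ) % 3) ?_
    ![(2, -1), (-1, 2), (-2, 2), (-2, 4), (-4, -4), (4, -2)] (by decide)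
    (fun _ _ => False) (by decide +kernel) (by decide +kernel) (by simp) (by simp)
  · rintro ⟨i, k⟩ ⟨j, l⟩ h
    have hk := k.2
    have hl := l.2
    have hij : i = j := by
      fin_cases i <;> fin_cases j <;> first | rfl | (exfalso; simp at h hk hl; omega)
    subst hij
    exact sigma_fin_ext rfl (by simpa using h)
  · rintro ⟨i, k⟩ ⟨j, l⟩ h
    have : (i : ℕ) ≠ j := fun h' => h (Fin.ext h')
    simp only
    omega

/-- The parts of a complete multipartite graph. -/
def completeMultipartitePart {k : ℕ} (a : Fin k → ℕ) (i : Fin k) : Finset (Σ i : Fin k, Fin (a i)) :=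
  Finset.univ.map ⟨Sigma.mk i, sigma_mk_injective⟩

theorem mem_completeMultipartitePart {k : ℕ} {a : Fin k → ℕ} {i : Fin k}
    {v : Σ i : Fin k, Fin (a i)} : v ∈ completeMultipartitePart a i ↔ v.1 = i := by
  simp only [completeMultipartitePart, Finset.mem_map, Finset.mem_univ, true_and]
  constructor
  · rintro ⟨x, rfl⟩
    rfl
  · rintro rfl
    exact ⟨v.2, rfl⟩

theorem card_completeMultipartitePart {k : ℕ} (a : Fin k → ℕ) (i : Fin k) :
    (completeMultipartitePart a i).card = a i := by
  simp [completeMultipartitePart]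

theorem disjoint_completeMultipartitePart {k : ℕ} {a : Fin k → ℕ} {i j : Fin k} (h : i ≠ j) :
    Disjoint (completeMultipartitePart a i) (completeMultipartitePart a j) :=
  Finset.disjoint_left.2 fun _ hx hy =>
    h ((mem_completeMultipartitePart.1 hx).symm.trans (mem_completeMultipartitePart.1 hy))

theorem adj_of_mem_completeMultipartitePart {k : ℕ} {a : Fin k → ℕ} {i j : Fin k} (h : i ≠ j)
    {v w : Σ i : Fin k, Fin (a i)} (hv : v ∈ completeMultipartitePart a i)
    (hw : w ∈ completeMultipartitePart a j) : (completeMultipartite a).Adj v w := by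
  rw [mem_completeMultipartitePart] at hv hw
  subst hv hw
  exact h

theorem not_nicPlanar_completeMultipartite {a₁ a₂ a₃ : ℕ} (h₃ : 0 < a₃) (h₁ : 3 ≤ a₁)
    (h₂ : 3 ≤ a₂) : ¬(completeMultipartite ![a₁, a₂, a₃]).NICPlanar := by
  rintro ⟨D, hD⟩
  obtain ⟨A, hA, hA3⟩ := Finset.exists_subset_card_eq
    (s := completeMultipartitePart ![a₁, a₂, a₃] 0) (n := 3)
    (by rw [card_completeMultipartitePart]; exact h₁)
  obtain ⟨B, hB, hB3⟩ := Finset.exists_subset_card_eq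
    (s := completeMultipartitePart ![a₁, a₂, a₃] 1) (n := 3)
    (by rw [card_completeMultipartitePart]; exact h₂)
  obtain ⟨c, hc⟩ : (completeMultipartitePart ![a₁, a₂, a₃] 2).Nonempty :=
    Finset.card_pos.1 (by rw [card_completeMultipartitePart]; exact h₃)
  exact hD.not_complete_three_three_one hA3 hB3
    (fun x hx y hy => adj_of_mem_completeMultipartitePart (by decide) (hA hx) (hB hy))
    (fun x hx => adj_of_mem_completeMultipartitePart (by decide) hc (hA hx))
    (fun x hx => adj_of_mem_completeMultipartitePart (by decide) hc (hB hx))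

theorem not_nicPlanar_completeMultipartite_two_one {a : ℕ} (h : 5 ≤ a) :
    ¬(completeMultipartite ![a, 2, 1]).NICPlanar := by
  rintro ⟨D, hD⟩
  obtain ⟨B, hB, hB5⟩ := Finset.exists_subset_card_eq
    (s := completeMultipartitePart ![a, 2, 1] 0) (n := 5)
    (by rw [card_completeMultipartitePart]; exact h)
  refine hD.not_complete_three_five
    (A := completeMultipartitePart ![a, 2, 1] 1 ∪ completeMultipartitePart ![a, 2, 1] 2) ?_ hB5 ?_
  · rw [Finset.card_union_of_disjoint (disjoint_completeMultipartitePart (by decide)),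
      card_completeMultipartitePart, card_completeMultipartitePart]
    rfl
  · intro x hx y hy
    rcases Finset.mem_union.1 hx with hx | hx <;>
      exact adj_of_mem_completeMultipartitePart (by decide) hx (hB hy)

theorem not_nicPlanar_completeMultipartite_two_two {a : ℕ} (h : 3 ≤ a) :
    ¬(completeMultipartite ![a, 2, 2]).NICPlanar := by
  rintro ⟨D, hD⟩
  obtain ⟨A, hA, hA3⟩ := Finset.exists_subset_card_eq
    (s := completeMultipartitePart ![a, 2, 2] 0) (n := 3)
    (by rw [card_completeMultipartitePart]; exact h)
  have hpart : ∀ i : Fin 3, i ≠ 0 → (completeMultipartitePart ![a, 2, 2] i).card = 2 := by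
    intro i hi
    rw [card_completeMultipartitePart]
    fin_cases i
    exacts [absurd rfl hi, rfl, rfl]
  refine hD.not_complete_three_two_two (B := completeMultipartitePart ![a, 2, 2] 1 ∪
    completeMultipartitePart ![a, 2, 2] 2) hA3 ?_ ?_ ?_
  · rw [Finset.card_union_of_disjoint (disjoint_completeMultipartitePart (by decide)),
      hpart 1 (by decide), hpart 2 (by decide)]
  · intro x hx y hy
    rcases Finset.mem_union.1 hy with hy | hy <;>
      exact adj_of_mem_completeMultipartitePart (by decide) (hA hx) hy
  · intro q hq s _ x _ hqs hqx hsx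
    by_contra! hcon
    have h1 : q.1 = s.1 := not_not.1 hcon.1
    have h2 : q.1 = x.1 := not_not.1 hcon.2
    have hq0 : q.1 ≠ 0 := by
      intro h0
      rcases Finset.mem_union.1 hq with hq | hq <;>
        simp [mem_completeMultipartitePart, h0] at hq
    have hsub : ({q, s, x} : Finset _) ⊆ completeMultipartitePart ![a, 2, 2] q.1 := by
      simp [Finset.insert_subset_iff, mem_completeMultipartitePart, ← h1, ← h2]
    have hcard := Finset.card_le_card hsub
    rw [hpart _ hq0, Finset.card_eq_three.2 ⟨q, s, x, hqs, hqx, hsx, rfl⟩] at hcard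
    omega

/-- for positive integers `a₁ ≥ a₂ ≥ a₃`, the complete 3-partite
graph `K_{a₁,a₂,a₃}` is NIC-planar iff `a₂ = 1`, or `a₁ ≤ 4`, `a₂ = 2` and
`a₃ = 1`, or `a₁ = a₂ = a₃ = 2`. -/
theorem stmt6 (a₁ a₂ a₃ : ℕ) (h₃ : 0 < a₃) (h₃₂ : a₃ ≤ a₂) (h₂₁ : a₂ ≤ a₁) :
    (completeMultipartite ![a₁, a₂, a₃]).NICPlanar ↔
      a₂ = 1 ∨ (a₁ ≤ 4 ∧ a₂ = 2 ∧ a₃ = 1) ∨ (a₁ = 2 ∧ a₂ = 2 ∧ a₃ = 2) := by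

  constructor
  · intro h
    by_contra! hcon
    obtain ⟨h1, h2, h3⟩ := hcon
    rcases (show 3 ≤ a₂ ∨ a₂ = 2 by omega) with h4 | rfl
    · exact not_nicPlanar_completeMultipartite h₃ (h4.trans h₂₁) h4 h
    · rcases (show a₃ = 1 ∨ a₃ = 2 by omega) with rfl | rfl
      · exact not_nicPlanar_completeMultipartite_two_one (by grind) h
      · exact not_nicPlanar_completeMultipartite_two_two (by grind) h
  · rintro (rfl | ⟨h, rfl, rfl⟩ | ⟨rfl, rfl, rfl⟩)
    · obtain rfl : a₃ = 1 := by omega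
      exact nicPlanar_completeMultipartite_one_one a₁
    · exact nicPlanar_completeMultipartite_two_one h
    · exact nicPlanar_completeMultipartite_two_two
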